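/- arXiv:2412.17193 — 4 statements merged into one kernel-verified Lean document; each statement's English description precedes it below -/
import Mathlib

section
/- For every ε > 0 and every real σ > 18/ε² the following holds: for every δ > 0 there exists ω₀ ∈ ℕ such that for every integer ω ≥ ω₀ and every proper deterministic online coloring algorithm A with unknown representation, there exists a finite sequence of closed intervals in ℝ, each of length at least 1 and less than σ, whose clique number is at most ω, such that when the associated interval graph is presented to A vertex by vertex in the order of the sequence, A uses at least (3 − ε − δ)·ω colors. -/
/-- The interval graph determined by a finite sequence of closed intervals
(each given as a pair of endpoints): vertices `i` and `j` are adjacent iff the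
corresponding closed intervals intersect. -/
def intervalGraph {n : ℕ} (x : Fin n → ℝ × ℝ) : SimpleGraph (Fin n) :=
  SimpleGraph.fromRel
    (fun i j => (Set.Icc (x i).1 (x i).2 ∩ Set.Icc (x j).1 (x j).2).Nonempty)

/-- A deterministic online coloring algorithm with unknown representation:
it assigns to each finite simple graph on ordered vertex set `Fin (i+1)` a
color for the last vertex. -/
def OnlineAlg : Type := ∀ i : ℕ, SimpleGraph (Fin (i + 1)) → ℕ

/-- The coloring produced when a graph `G` on `Fin n` is presented to the
algorithm `A` vertex by vertex: vertex `i` is colored according to the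
induced subgraph on the first `i+1` vertices. -/
def onlineColoring (A : OnlineAlg) {n : ℕ} (G : SimpleGraph (Fin n)) (i : Fin n) : ℕ :=
  A i.1 (G.comap (Fin.castLE i.isLt))

/-- The algorithm `A` is proper: on every presented graph, adjacent vertices
receive distinct colors. -/
def IsProper (A : OnlineAlg) : Prop :=
  ∀ (n : ℕ) (G : SimpleGraph (Fin n)) (i j : Fin n),
    G.Adj i j → onlineColoring A G i ≠ onlineColoring A G j

namespace OnlineIntervals

open Finset

/-- The color given to vertex `i` when the graph `G` is presented in the natural order. -/
def color (A : OnlineAlg) (G : SimpleGraph ℕ) (i : ℕ) : ℕ :=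
  A i (G.comap (fun j : Fin (i + 1) => (j : ℕ)))

/-- The set of colors used on `U`. -/
def colors (A : OnlineAlg) (G : SimpleGraph ℕ) (U : Finset ℕ) : Finset ℕ :=
  U.image (color A G)

/-- The graphs `G` and `H` agree on the first `n` vertices. -/
def AgreeBelow (n : ℕ) (G H : SimpleGraph ℕ) : Prop :=
  ∀ a < n, ∀ b < n, (H.Adj a b ↔ G.Adj a b)

/-- The closed intervals with endpoints `a` and `b` intersect (if both are nonempty). -/
def Meets (a b : ℝ × ℝ) : Prop := a.1 ≤ b.2 ∧ b.1 ≤ a.2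

/-- The function with value `w` on `[p, q]` and `0` elsewhere. -/
noncomputable def box (w : ℕ) (p q t : ℝ) : ℕ :=
  open Classical in if p ≤ t ∧ t ≤ q then w else 0

/-- Translation of an interval. -/
def shift (s : ℝ) (a : ℝ × ℝ) : ℝ × ℝ := (a.1 + s, a.2 + s)

/-- Reflection of an interval in the origin. -/
def reflect (a : ℝ × ℝ) : ℝ × ℝ := (-a.2, -a.1)

open Classical in
/-- Among the first `n` vertices of `G`, the set `U` is a union of components, represented by the
intervals `x` with lengths in `[1, σ)`, at most `f t` of which contain the point `t`. -/
structure Represents (σ : ℝ) (G : SimpleGraph ℕ) (n : ℕ) (U : Finset ℕ) (x : ℕ → ℝ × ℝ)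
    (f : ℝ → ℕ) : Prop where
  lt : ∀ i ∈ U, i < n
  closed : ∀ i ∈ U, ∀ j < n, j ∉ U → ¬ G.Adj i j
  length : ∀ i ∈ U, 1 ≤ (x i).2 - (x i).1 ∧ (x i).2 - (x i).1 < σ
  adj : ∀ i ∈ U, ∀ j ∈ U, i ≠ j → (G.Adj i j ↔ Meets (x i) (x j))
  count : ∀ t, #{i ∈ U | (x i).1 ≤ t ∧ t ≤ (x i).2} ≤ f t

/-- The first `n` vertices of `G` form an interval graph with admissible lengths and clique number
at most `ω`. -/
def Admissible (σ : ℝ) (ω : ℕ) (G : SimpleGraph ℕ) (n : ℕ) : Prop :=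
  ∃ x lo hi, Represents σ G n (range n) x (box ω lo hi)

/-- `H` arises from `G` by adding the vertices in `[n, k)`, none adjacent to an earlier vertex. -/
structure FreshExtension (n : ℕ) (G : SimpleGraph ℕ) (k : ℕ) (H : SimpleGraph ℕ) : Prop where
  le : n ≤ k
  agree : AgreeBelow n G H
  fresh : ∀ a < n, ∀ b, n ≤ b → b < k → ¬ H.Adj a b

/-- Every color used on `U` is used on an interval of `U` meeting `[p, q]`. -/
def MeetsAllColors (A : OnlineAlg) (G : SimpleGraph ℕ) (U : Finset ℕ) (x : ℕ → ℝ × ℝ)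
    (p q : ℝ) : Prop :=
  ∀ i ∈ U, ∃ j ∈ U, color A G j = color A G i ∧ Meets (x j) (p, q)

variable {A : OnlineAlg} {σ : ℝ} {ω n k m : ℕ} {G H K : SimpleGraph ℕ} {U V : Finset ℕ}
  {x y : ℕ → ℝ × ℝ} {f g : ℝ → ℕ} {p q : ℝ}

theorem AgreeBelow.color_eq (h : AgreeBelow n G H) {i : ℕ} (hi : i < n) :
    color A H i = color A G i := by
  unfold color
  congr 1
  ext a b
  exact h a (by have := a.2; omega) b (by have := b.2; omega)

theorem AgreeBelow.colors_eq (h : AgreeBelow n G H) (hU : ∀ i ∈ U, i < n) :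
    colors A H U = colors A G U :=
  image_congr fun _ hi => h.color_eq (hU _ hi)

theorem colors_union : colors A G (U ∪ V) = colors A G U ∪ colors A G V :=
  image_union ..

theorem onlineColoring_comap_val (i : Fin n) :
    onlineColoring A (G.comap (fun j : Fin n => (j : ℕ))) i = color A G i := rfl

theorem color_ne (hA : IsProper A) {i j : ℕ} (h : G.Adj i j) : color A G i ≠ color A G j :=
  hA (max i j + 1) (G.comap fun a : Fin (max i j + 1) => (a : ℕ)) ⟨i, by omega⟩ ⟨j, by omega⟩ h

theorem Meets.symm {a b : ℝ × ℝ} (h : Meets a b) : Meets b a := ⟨h.2, h.1⟩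

theorem FreshExtension.trans {l : ℕ} (h : FreshExtension n G k H) (h' : FreshExtension k H l K) :
    FreshExtension n G l K where
  le := h.le.trans h'.le
  agree a ha b hb := by
    have := h.le
    exact (h'.agree a (by omega) b (by omega)).trans (h.agree a ha b hb)
  fresh a ha b hb hbl := by
    have := h.le
    by_cases hk : b < k
    · rw [h'.agree a (by omega) b hk]
      exact h.fresh a ha b hb hk
    · exact h'.fresh a (by omega) b (by omega) hbl

theorem FreshExtension.refl (n : ℕ) (G : SimpleGraph ℕ) : FreshExtension n G n G where
  le := le_rfl
  agree _ _ _ _ := Iff.rfl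
  fresh _ _ b hb hb' := by omega

namespace Represents

theorem mono (h : Represents σ G n U x f) (hfg : ∀ t, f t ≤ g t) : Represents σ G n U x g :=
  { h with count := fun t => (h.count t).trans (hfg t) }

theorem ext (h : Represents σ G n U x f) (e : FreshExtension n G k H) :
    Represents σ H k U x f where
  lt i hi := (h.lt i hi).trans_le e.le
  closed i hi j hj hjU := by
    by_cases hn : j < n
    · rw [e.agree i (h.lt i hi) j hn]
      exact h.closed i hi j hn hjU
    · exact e.fresh i (h.lt i hi) j (by omega) hj
  length := h.length
  adj i hi j hj hij := by
    rw [e.agree i (h.lt i hi) j (h.lt j hj)]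
    exact h.adj i hi j hj hij
  count := h.count

theorem shift (h : Represents σ G n U x f) (s : ℝ) :
    Represents σ G n U (fun i => shift s (x i)) (fun t => f (t - s)) where
  lt := h.lt
  closed := h.closed
  length i hi := by
    have := h.length i hi
    simpa [OnlineIntervals.shift] using this
  adj i hi j hj hij := by
    rw [h.adj i hi j hj hij]
    simp [OnlineIntervals.shift, Meets]
  count t := by
    refine (card_le_card fun i hi => ?_).trans (h.count (t - s))
    rw [mem_filter] at hi ⊢
    simpa only [OnlineIntervals.shift, le_sub_iff_add_le, sub_le_iff_le_add] using hi

theorem reflect (h : Represents σ G n U x f) :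
    Represents σ G n U (fun i => reflect (x i)) (fun t => f (-t)) where
  lt := h.lt
  closed := h.closed
  length i hi := by
    have := h.length i hi
    simp only [OnlineIntervals.reflect]
    constructor <;> linarith
  adj i hi j hj hij := by
    rw [h.adj i hi j hj hij]
    simp only [OnlineIntervals.reflect, Meets, neg_le_neg_iff]
    exact and_comm
  count t := by
    have := h.count (-t)
    simpa only [OnlineIntervals.reflect, neg_le, le_neg, and_comm] using this

theorem apply_left_pos (h : Represents σ G n U x f) {i : ℕ} (hi : i ∈ U) : 0 < f (x i).1 := by
  classical
  refine lt_of_lt_of_le (card_pos.2 ⟨i, ?_⟩) (h.count (x i).1)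
  have := h.length i hi
  simp only [mem_filter]
  exact ⟨hi, le_rfl, by linarith⟩

theorem apply_right_pos (h : Represents σ G n U x f) {i : ℕ} (hi : i ∈ U) : 0 < f (x i).2 := by
  classical
  refine lt_of_lt_of_le (card_pos.2 ⟨i, ?_⟩) (h.count (x i).2)
  have := h.length i hi
  simp only [mem_filter]
  exact ⟨hi, by linarith, le_rfl⟩

/-- Two disjoint represented sets placed on the two sides of a point `c`. -/
theorem union (h : Represents σ G n U x f) (h' : Represents σ G n V y g) (hd : Disjoint U V)
    (c : ℝ) (hf : ∀ t, c ≤ t → f t = 0) (hg : ∀ t, t ≤ c → g t = 0) :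
    Represents σ G n (U ∪ V) (fun i => if i ∈ U then x i else y i) (fun t => f t + g t) := by
  classical
  have hV : ∀ i ∈ V, i ∉ U := fun i hi hU => disjoint_left.1 hd hU hi
  have hx : ∀ i ∈ U, (x i).2 < c := fun i hi => by
    by_contra! hc
    exact (h.apply_right_pos hi).ne' (hf _ hc)
  have hy : ∀ i ∈ V, c < (y i).1 := fun i hi => by
    by_contra! hc
    exact (h'.apply_left_pos hi).ne' (hg _ hc)
  refine ⟨?_, ?_, ?_, ?_, ?_⟩
  · intro i hi
    rcases mem_union.1 hi with hi | hi
    exacts [h.lt i hi, h'.lt i hi]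
  · intro i hi j hj hjU
    rw [mem_union, not_or] at hjU
    rcases mem_union.1 hi with hi | hi
    exacts [h.closed i hi j hj hjU.1, h'.closed i hi j hj hjU.2]
  · intro i hi
    rcases mem_union.1 hi with hi | hi
    · simpa [hi] using h.length i hi
    · simpa [hV i hi] using h'.length i hi
  · intro i hi j hj hij
    rcases mem_union.1 hi with hi | hi <;> rcases mem_union.1 hj with hj | hj
    · simpa [hi, hj] using h.adj i hi j hj hij
    · have h1 := h.closed i hi j (h'.lt j hj) (hV j hj)
      have h2 := hx i hi
      have h3 := hy j hj
      simp only [h1, hi, hV j hj, if_true, if_false, Meets, false_iff, not_and]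
      intro _
      linarith
    · have h1 := h.closed j hj i (h'.lt i hi) (hV i hi)
      have h2 := hx j hj
      have h3 := hy i hi
      rw [G.adj_comm]
      simp only [h1, hj, hV i hi, if_true, if_false, Meets, false_iff, not_and]
      intro _
      linarith
    · simpa [hV i hi, hV j hj] using h'.adj i hi j hj hij
  · intro t
    rw [filter_union]
    refine (card_union_le _ _).trans (Nat.add_le_add ((card_le_card ?_).trans (h.count t))
      ((card_le_card ?_).trans (h'.count t)))
    · intro i hi
      rw [mem_filter] at hi ⊢
      simpa [hi.1] using hi
    · intro i hi
      rw [mem_filter] at hi ⊢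
      simpa [hV i hi.1] using hi

/-- A representation of a union of components together with a representation of the remaining
vertices yields a representation of all vertices. -/
theorem admissible {lo hi lo' hi' : ℝ} (h : Represents σ G n U x (box ω lo hi))
    (h' : Represents σ G n (range n \ U) y (box ω lo' hi')) : Admissible σ ω G n := by
  have key := h.union (h'.shift (hi + 2 - lo')) disjoint_sdiff (hi + 1)
    (fun t ht => by unfold box; rw [if_neg]; rintro ⟨-, h2⟩; linarith)
    (fun t ht => by unfold box; rw [if_neg]; rintro ⟨h1, -⟩; linarith)
  rw [union_sdiff_of_subset fun i hi => mem_range.2 (h.lt i hi)] at key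
  refine ⟨_, min lo (hi + 2), max hi (hi' + (hi + 2 - lo')), key.mono fun t => ?_⟩
  simp only [box, min_le_iff, le_max_iff]
  split_ifs with h1 h2 h3 h3 h2 h3 h3 <;> first | omega | skip
  · linarith [h1.2, h2.1]
  · linarith [h1.2, h2.1]
  · exact absurd ⟨Or.inl h1.1, Or.inl h1.2⟩ h3
  · exact absurd ⟨Or.inr (by linarith [h2.1]), Or.inr (by linarith [h2.2])⟩ h3

/-- A represented set restricts to a union of components. -/
theorem subset (h : Represents σ G n U x f) (hV : V ⊆ U)
    (hc : ∀ i ∈ V, ∀ j < n, j ∉ V → ¬ G.Adj i j) : Represents σ G n V x f where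
  lt i hi := h.lt i (hV hi)
  closed := hc
  length i hi := h.length i (hV hi)
  adj i hi j hj := h.adj i (hV hi) j (hV hj)
  count t := (card_le_card (filter_subset_filter _ hV)).trans (h.count t)

theorem endpoints_of_box {w : ℕ} (h : Represents σ G n U x (box w p q)) {i : ℕ} (hi : i ∈ U) :
    p ≤ (x i).1 ∧ (x i).2 ≤ q := by
  have h1 := (h.apply_left_pos hi).ne'
  have h2 := (h.apply_right_pos hi).ne'
  simp only [box, ne_eq, ite_eq_right_iff, not_forall] at h1 h2
  exact ⟨h1.1.1, h2.1.2⟩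

end Represents

/-- `H`, `V`, `y` arise from `G`, `U`, `x` by presenting `m` new vertices represented by the
interval `[p, q]`. -/
structure Attachment (A : OnlineAlg) (σ : ℝ) (ω : ℕ) (G : SimpleGraph ℕ) (n : ℕ) (U : Finset ℕ)
    (x : ℕ → ℝ × ℝ) (f : ℝ → ℕ) (m : ℕ) (p q : ℝ) (H : SimpleGraph ℕ) (V : Finset ℕ)
    (y : ℕ → ℝ × ℝ) : Prop where
  agree : AgreeBelow n G H
  admissible : Admissible σ ω H (n + m)
  represents : Represents σ H (n + m) V y (fun t => f t + box m p q t)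
  subset : U ⊆ V
  mem : ∀ i, n ≤ i → i < n + m → i ∈ V
  old : ∀ i ∈ U, i < n ∧ y i = x i
  new : ∀ i ∈ V, i ∉ U → n ≤ i ∧ y i = (p, q)
  card_colors : MeetsAllColors A G U x p q → #(colors A H V) = #(colors A G U) + m

theorem Represents.exists_attachment (hA : IsProper A) (h : Represents σ G n U x f)
    (hG : Admissible σ ω G n) (m : ℕ) (hpq : 1 ≤ q - p) (hpq' : q - p < σ) {lo hi : ℝ}
    (hf : ∀ t, f t + box m p q t ≤ box ω lo hi t) :
    ∃ H V y, Attachment A σ ω G n U x f m p q H V y := by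
  classical
  set V := U ∪ Ico n (n + m) with hVdef
  set y : ℕ → ℝ × ℝ := fun i => if i < n then x i else (p, q) with hy
  have yold : ∀ i < n, y i = x i := fun i hi => by simp [hy, hi]
  have ynew : ∀ i, n ≤ i → y i = (p, q) := fun i hi => by simp [hy, Nat.not_lt.2 hi]
  let H : SimpleGraph ℕ :=
    { Adj := fun i j => i ≠ j ∧ ((i < n ∧ j < n ∧ G.Adj i j) ∨
        ((n ≤ i ∨ n ≤ j) ∧ i ∈ V ∧ j ∈ V ∧ Meets (y i) (y j)))
      symm := ⟨fun i j hij => ⟨hij.1.symm, hij.2.imp (fun h => ⟨h.2.1, h.1, h.2.2.symm⟩)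
        (fun h => ⟨h.1.symm, h.2.2.1, h.2.1, h.2.2.2.symm⟩)⟩⟩
      loopless := ⟨fun i hi => hi.1 rfl⟩ }
  have hadj : ∀ i j, H.Adj i j ↔ i ≠ j ∧ ((i < n ∧ j < n ∧ G.Adj i j) ∨
        ((n ≤ i ∨ n ≤ j) ∧ i ∈ V ∧ j ∈ V ∧ Meets (y i) (y j))) := fun i j => Iff.rfl
  have memV : ∀ i, i ∈ V ↔ i ∈ U ∨ (n ≤ i ∧ i < n + m) := fun i => by simp [hVdef]
  have agree : AgreeBelow n G H := by
    intro a ha b hb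
    rw [hadj]
    constructor
    · rintro ⟨-, h1 | h1⟩
      · exact h1.2.2
      · omega
    · exact fun hab => ⟨hab.ne, Or.inl ⟨ha, hb, hab⟩⟩
  have hrep : Represents σ H (n + m) V y (fun t => f t + box m p q t) := by
    refine ⟨?_, ?_, ?_, ?_, ?_⟩
    · intro i hi
      rcases (memV i).1 hi with hi | hi
      · have := h.lt i hi
        omega
      · exact hi.2
    · rintro i hi j hj hjV ⟨-, h1 | h1⟩
      · rw [memV] at hi hjV
        rcases hi with hi | hi
        · exact h.closed i hi j h1.2.1 (fun hj => hjV (Or.inl hj)) h1.2.2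
        · omega
      · exact hjV h1.2.2.1
    · intro i hi
      rcases (memV i).1 hi with hi | hi
      · rw [yold i (h.lt i hi)]
        exact h.length i hi
      · rw [ynew i hi.1]
        exact ⟨hpq, hpq'⟩
    · intro i hi j hj hij
      by_cases hn : i < n ∧ j < n
      · have hiU : i ∈ U := ((memV i).1 hi).resolve_right (by omega)
        have hjU : j ∈ U := ((memV j).1 hj).resolve_right (by omega)
        rw [agree i hn.1 j hn.2, yold i hn.1, yold j hn.2]
        exact h.adj i hiU j hjU hij
      · rw [hadj]
        constructor
        · rintro ⟨-, h1 | h1⟩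
          · exact absurd ⟨h1.1, h1.2.1⟩ hn
          · exact h1.2.2.2
        · exact fun hm => ⟨hij, Or.inr ⟨by omega, hi, hj, hm⟩⟩
    · intro t
      rw [hVdef, filter_union]
      refine (card_union_le _ _).trans (Nat.add_le_add ((card_le_card ?_).trans (h.count t)) ?_)
      · intro i hi
        rw [mem_filter] at hi ⊢
        rwa [yold i (h.lt i hi.1)] at hi
      · unfold box
        split_ifs with ht
        · exact (card_filter_le _ _).trans (by simp)
        · rw [Nat.le_zero, card_eq_zero, filter_eq_empty_iff]
          intro i hi
          rw [ynew i (mem_Ico.1 hi).1]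
          exact ht
  have hproper : ∀ i j, H.Adj i j → color A H i ≠ color A H j := fun i j => color_ne hA
  have hadjnew : ∀ i ∈ V, ∀ j, n ≤ j → j < n + m → i ≠ j → Meets (y i) (p, q) → H.Adj i j := by
    intro i hi j hj hj' hij hm
    have hjV : j ∈ V := (memV j).2 (Or.inr ⟨hj, hj'⟩)
    rw [hrep.adj i hi j hjV hij, ynew j hj]
    exact hm
  refine ⟨H, V, y, agree, ?_, hrep, subset_union_left, fun i hi hi' => (memV i).2 (Or.inr ⟨hi, hi'⟩),
    fun i hi => ⟨h.lt i hi, yold i (h.lt i hi)⟩, ?_, ?_⟩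
  · obtain ⟨z, lo', hi', hz⟩ := hG
    refine (hrep.mono hf).admissible (y := z) (lo' := lo') (hi' := hi') ?_
    have hmem : ∀ i, i ∈ range (n + m) \ V ↔ i < n ∧ i ∉ U := by
      intro i
      rw [mem_sdiff, mem_range, memV]
      have := h.lt i
      constructor
      · rintro ⟨h1, h2⟩
        rw [not_or] at h2
        exact ⟨by omega, h2.1⟩
      · rintro ⟨h1, h2⟩
        exact ⟨by omega, fun h3 => h3.elim h2 (by omega)⟩
    refine ⟨fun i hi => mem_range.1 (mem_sdiff.1 hi).1, ?_, fun i hi => hz.length i ?_, ?_, ?_⟩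
    · intro i hi j hj hjV hij
      have hjV' : j ∈ V := by
        by_contra hcon
        exact hjV (mem_sdiff.2 ⟨mem_range.2 hj, hcon⟩)
      rw [mem_sdiff, mem_range] at hi
      exact hrep.closed j hjV' i hi.1 hi.2 hij.symm
    · exact mem_range.2 ((hmem i).1 hi).1
    · intro i hi j hj hij
      have hi' := ((hmem i).1 hi).1
      have hj' := ((hmem j).1 hj).1
      rw [agree i hi' j hj']
      exact hz.adj i (mem_range.2 hi') j (mem_range.2 hj') hij
    · intro t
      refine (card_le_card (filter_subset_filter _ ?_)).trans (hz.count t)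
      exact fun i hi => mem_range.2 ((hmem i).1 hi).1
  · intro i hi hiU
    have := ((memV i).1 hi).resolve_left hiU
    exact ⟨this.1, ynew i this.1⟩
  · intro hm
    have hself : Meets (p, q) (p, q) := by
      constructor <;> simp only <;> linarith
    have hU : colors A H U = colors A G U := agree.colors_eq h.lt
    have hnew : #(colors A H (Ico n (n + m))) = m := by
      rw [colors, card_image_of_injOn, Nat.card_Ico, Nat.add_sub_cancel_left]
      intro i hi j hj hij
      rw [coe_Ico, Set.mem_Ico] at hi hj
      by_contra hne
      refine hproper i j (hadjnew i ((memV i).2 (Or.inr hi)) j hj.1 hj.2 hne ?_) hij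
      rw [ynew i hi.1]
      exact hself
    have hdisj : Disjoint (colors A H U) (colors A H (Ico n (n + m))) := by
      rw [disjoint_left]
      intro c hc hc'
      obtain ⟨i, hi, rfl⟩ := mem_image.1 hc
      obtain ⟨j, hj, hji⟩ := mem_image.1 hc'
      rw [mem_Ico] at hj
      obtain ⟨l, hl, hli, hlm⟩ := hm i hi
      have hln := h.lt l hl
      rw [← agree.color_eq hln, ← agree.color_eq (h.lt i hi)] at hli
      refine hproper l j (hadjnew l ((memV l).2 (Or.inl hl)) j hj.1 hj.2 (by omega) ?_)
        (hli.trans hji.symm)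
      rw [yold l hln]
      exact hlm
    rw [hVdef, colors_union, card_union_of_disjoint hdisj, hU, hnew]

theorem Attachment.freshExtension {n₀ : ℕ} {G₀ : SimpleGraph ℕ}
    (h : Attachment A σ ω G n U x f m p q H V y) (e : FreshExtension n₀ G₀ n G)
    (hU : U ⊆ Ico n₀ n) : FreshExtension n₀ G₀ (n + m) H ∧ V ⊆ Ico n₀ (n + m) := by
  have hle := e.le
  have hV : V ⊆ Ico n₀ (n + m) := by
    intro i hi
    have h1 := h.represents.lt i hi
    rw [mem_Ico]
    by_cases hiU : i ∈ U
    · have := mem_Ico.1 (hU hiU)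
      omega
    · have := h.new i hi hiU
      omega
  refine ⟨⟨by omega, ?_, ?_⟩, hV⟩
  · intro a ha b hb
    exact (h.agree a (by omega) b (by omega)).trans (e.agree a ha b hb)
  · intro a ha b hb hbm hab
    by_cases hbn : b < n
    · exact e.fresh a ha b hb hbn ((h.agree a (by omega) b hbn).1 hab)
    · refine h.represents.closed b (h.mem b (by omega) hbm) a (by omega) (fun haV => ?_) hab.symm
      have := mem_Ico.1 (hV haV)
      omega

namespace MeetsAllColors

theorem mono {p' q' : ℝ} (h : MeetsAllColors A G U x p q) (hp : p' ≤ p) (hq : q ≤ q') :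
    MeetsAllColors A G U x p' q' := by
  intro i hi
  obtain ⟨j, hj, hji, h1, h2⟩ := h i hi
  exact ⟨j, hj, hji, h1.trans hq, hp.trans h2⟩

theorem shift (h : MeetsAllColors A G U x p q) (s : ℝ) :
    MeetsAllColors A G U (fun i => shift s (x i)) (p + s) (q + s) := by
  intro i hi
  obtain ⟨j, hj, hji, h1, h2⟩ := h i hi
  exact ⟨j, hj, hji, by simpa [OnlineIntervals.shift] using h1,
    by simpa [OnlineIntervals.shift] using h2⟩

theorem reflect (h : MeetsAllColors A G U x p q) :
    MeetsAllColors A G U (fun i => reflect (x i)) (-q) (-p) := by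
  intro i hi
  obtain ⟨j, hj, hji, h1, h2⟩ := h i hi
  exact ⟨j, hj, hji, by simpa [OnlineIntervals.reflect] using h2,
    by simpa [OnlineIntervals.reflect] using h1⟩

theorem union_left (h : MeetsAllColors A G U x p q) (hc : colors A G U = colors A G V) :
    MeetsAllColors A G (U ∪ V) (fun i => if i ∈ U then x i else y i) p q := by
  intro i hi
  have hi' : color A G i ∈ colors A G U := by
    rcases mem_union.1 hi with hi | hi
    · exact mem_image_of_mem _ hi
    · rw [hc]
      exact mem_image_of_mem _ hi
  obtain ⟨l, hl, hli⟩ := mem_image.1 hi'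
  obtain ⟨j, hj, hjl, hm⟩ := h l hl
  exact ⟨j, mem_union_left _ hj, hjl.trans hli, by simpa [hj] using hm⟩

theorem union_right (h : MeetsAllColors A G V y p q) (hc : colors A G U = colors A G V)
    (hd : Disjoint U V) :
    MeetsAllColors A G (U ∪ V) (fun i => if i ∈ U then x i else y i) p q := by
  intro i hi
  obtain ⟨j, hj, hji, hm⟩ := h.union_left (V := U) (y := x) hc.symm i (union_comm U V ▸ hi)
  refine ⟨j, union_comm U V ▸ hj, hji, ?_⟩
  by_cases hjV : j ∈ V
  · simpa [hjV, disjoint_right.1 hd hjV] using hm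
  · have hjU : j ∈ U := (mem_union.1 hj).resolve_left hjV
    simpa [hjV, hjU] using hm

theorem of_box {w : ℕ} (h : Represents σ G n U x (box w p q)) : MeetsAllColors A G U x p q := by
  intro i hi
  have h1 := h.endpoints_of_box hi
  have h2 := h.length i hi
  refine ⟨i, hi, rfl, ?_, ?_⟩ <;> simp only <;> linarith

theorem attachment {p' q' : ℝ} (h : MeetsAllColors A G U x p' q')
    (a : Attachment A σ ω G n U x f m p q H V y) (hm : Meets (p, q) (p', q')) :
    MeetsAllColors A H V y p' q' := by
  intro i hi
  by_cases hiU : i ∈ U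
  · obtain ⟨j, hj, hji, hjm⟩ := h i hiU
    refine ⟨j, a.subset hj, ?_, by rwa [(a.old j hj).2]⟩
    rw [a.agree.color_eq (a.old j hj).1, a.agree.color_eq (a.old i hiU).1, hji]
  · exact ⟨i, hi, rfl, by rwa [(a.new i hi hiU).2]⟩

end MeetsAllColors

/-- `U` is a union of components of `G` with set of colors `τ`, represented with at most `f t`
intervals at each point `t` in such a way that `[p, q]` meets all the colors. -/
def IsGadget (A : OnlineAlg) (σ : ℝ) (G : SimpleGraph ℕ) (n : ℕ) (f : ℝ → ℕ) (p q : ℝ)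
    (U τ : Finset ℕ) : Prop :=
  ∃ x, Represents σ G n U x f ∧ MeetsAllColors A G U x p q ∧ colors A G U = τ

/-- Every admissible graph can be extended by fresh vertices containing a gadget with at least `c`
colors. -/
def Forces (A : OnlineAlg) (σ : ℝ) (ω : ℕ) (f : ℝ → ℕ) (p q : ℝ) (c : ℕ) : Prop :=
  ∀ n G, Admissible σ ω G n → ∃ k H U τ, FreshExtension n G k H ∧ Admissible σ ω H k ∧
    U ⊆ Ico n k ∧ IsGadget A σ H k f p q U τ ∧ c ≤ #τ

theorem IsGadget.ext {τ : Finset ℕ} (h : IsGadget A σ G n f p q U τ)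
    (e : FreshExtension n G k H) : IsGadget A σ H k f p q U τ := by
  obtain ⟨x, hx, hm, hc⟩ := h
  refine ⟨x, hx.ext e, ?_, (e.agree.colors_eq hx.lt).trans hc⟩
  intro i hi
  obtain ⟨j, hj, hji, hjm⟩ := hm i hi
  refine ⟨j, hj, ?_, hjm⟩
  rw [e.agree.color_eq (hx.lt j hj), e.agree.color_eq (hx.lt i hi), hji]

theorem IsGadget.subset_colors {τ : Finset ℕ} (h : IsGadget A σ G n f p q U τ) :
    τ ⊆ colors A G (range n) := by
  obtain ⟨x, hx, -, rfl⟩ := h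
  exact image_subset_image fun i hi => mem_range.2 (hx.lt i hi)

/-- If the number of colors is bounded, two gadgets with the same colors can be forced. -/
theorem Forces.exists_pair {c T : ℕ} (h : Forces A σ ω f p q c)
    (hT : ∀ n G, Admissible σ ω G n → #(colors A G (range n)) ≤ T)
    (hG : Admissible σ ω G n) :
    ∃ k H U V τ, FreshExtension n G k H ∧ Admissible σ ω H k ∧ U ⊆ Ico n k ∧ V ⊆ Ico n k ∧
      Disjoint U V ∧ IsGadget A σ H k f p q U τ ∧ IsGadget A σ H k f p q V τ ∧ c ≤ #τ := by
  classical
  by_contra hcon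
  have key : ∀ N : ℕ, ∃ (k : ℕ) (H : SimpleGraph ℕ) (S : Finset (Finset ℕ)),
      FreshExtension n G k H ∧ Admissible σ ω H k ∧ #S = N ∧
      ∀ τ ∈ S, ∃ U ⊆ Ico n k, IsGadget A σ H k f p q U τ := by
    intro N
    induction N with
    | zero => exact ⟨n, G, ∅, .refl n G, hG, by simp, by simp⟩
    | succ N ih =>
      obtain ⟨k, H, S, e, hH, hS, hU⟩ := ih
      obtain ⟨l, K, V, τ, e', hK, hV, hgad, hc⟩ := h k H hH
      have hk := e.le
      have hl := e'.le
      have hsub : ∀ W ⊆ Ico n k, W ⊆ Ico n l := fun W hW =>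
        hW.trans (Ico_subset_Ico_right hl)
      have hVn : V ⊆ Ico n l := hV.trans (Ico_subset_Ico_left hk)
      by_cases hτ : τ ∈ S
      · obtain ⟨U, hUn, hU'⟩ := hU τ hτ
        refine absurd ⟨l, K, U, V, τ, e.trans e', hK, hsub U hUn, hVn, ?_, hU'.ext e', hgad, hc⟩
          hcon
        rw [disjoint_left]
        intro i hi hi'
        have h1 := mem_Ico.1 (hUn hi)
        have h2 := mem_Ico.1 (hV hi')
        omega
      · refine ⟨l, K, insert τ S, e.trans e', hK, by rw [card_insert_of_notMem hτ, hS], ?_⟩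
        intro τ' hτ'
        rcases mem_insert.1 hτ' with rfl | hτ'
        · exact ⟨V, hVn, hgad⟩
        · obtain ⟨U, hUn, hU'⟩ := hU τ' hτ'
          exact ⟨U, hsub U hUn, hU'.ext e'⟩
  obtain ⟨k, H, S, -, hH, hS, hU⟩ := key (2 ^ T + 1)
  have hSub : S ⊆ (colors A H (range k)).powerset := by
    intro τ hτ
    obtain ⟨U, -, hU'⟩ := hU τ hτ
    exact mem_powerset.2 hU'.subset_colors
  have h1 := card_le_card hSub
  rw [card_powerset, hS] at h1
  have h2 := Nat.pow_le_pow_right (n := 2) (by norm_num) (hT k H hH)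
  omega

theorem forces_clique (hA : IsProper A) (hσ : 1 < σ) {w : ℕ} (hw : w ≤ ω) :
    Forces A σ ω (box w 0 1) 0 1 w := by
  intro n G hG
  have h0 : Represents σ G n ∅ (fun _ => (0, 1)) (fun _ => 0) :=
    ⟨by simp, by simp, by simp, by simp, by simp⟩
  obtain ⟨H, V, y, hat⟩ := h0.exists_attachment hA hG w (p := 0) (q := 1) (by norm_num)
    (by simpa using hσ) (lo := 0) (hi := 1)
    (fun t => by simp only [box]; split_ifs <;> omega)
  have hfresh := hat.freshExtension (FreshExtension.refl n G) (empty_subset _)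
  have hrep : Represents σ H (n + w) V y (box w 0 1) := hat.represents.mono fun t => by simp
  refine ⟨n + w, H, V, _, hfresh.1, hat.admissible, hfresh.2,
    ⟨y, hrep, .of_box hrep, rfl⟩, ?_⟩
  rw [hat.card_colors (fun i hi => absurd hi (notMem_empty i))]
  omega

/-- Overlap bound for a gadget on `[0, L]` followed by a gadget on `[L + 3/2, 2 * L + 3/2]`
covered by `m` copies of `[L + 1, 2 * L + 2]`. -/
noncomputable def pairBound (w m : ℕ) (L t : ℝ) : ℕ :=
  box w 0 L t + box w 0 L (t - (L + 3 / 2)) + box m (L + 1) (2 * L + 2) t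

theorem Forces.pair (hA : IsProper A) {T w c : ℕ} {L : ℝ}
    (hT : ∀ n G, Admissible σ ω G n → #(colors A G (range n)) ≤ T)
    (h : Forces A σ ω (box w 0 L) 0 L c) (hL : 0 ≤ L) (hLσ : L + 1 < σ) (hw : w + m ≤ ω) :
    Forces A σ ω (pairBound w m L) (-1) (L + 1) (c + m) := by
  intro n G hG
  obtain ⟨k, H, U, V, τ, e, hH, hUn, hVn, hd, ⟨x, hx, hxm, hxc⟩, ⟨y, hy, hym, hyc⟩, hc⟩ :=
    h.exists_pair hT hG
  have hcol : colors A H U = colors A H V := hxc.trans hyc.symm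
  have hrep := hx.union (hy.shift (L + 3 / 2)) hd (L + 1)
    (fun t ht => by unfold box; rw [if_neg]; rintro ⟨-, h2⟩; linarith)
    (fun t ht => by unfold box; rw [if_neg]; rintro ⟨h1, -⟩; linarith)
  have hright := (hym.shift (L + 3 / 2)).union_right (x := x) hcol hd
  have hleft := hxm.union_left (y := fun i => shift (L + 3 / 2) (y i)) hcol
  obtain ⟨K, W, z, hat⟩ := hrep.exists_attachment hA hH m (p := L + 1) (q := 2 * L + 2)
    (by linarith) (by linarith) (lo := 0) (hi := 2 * L + 2) (fun t => by
      simp only [box]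
      split_ifs <;> first | omega | grind)
  have hfresh := hat.freshExtension e (union_subset hUn hVn)
  refine ⟨k + m, K, W, _, hfresh.1, hat.admissible, hfresh.2, ⟨z, hat.represents,
    (hleft.mono (by linarith) (by linarith)).attachment hat ⟨?_, ?_⟩, rfl⟩, ?_⟩
  · simp
  · simp only
    linarith
  · rw [hat.card_colors (hright.mono (by linarith) (by linarith))]
    rw [colors_union, hxc, hyc, union_self]
    omega

theorem pairBound_of_neg {w : ℕ} {L t : ℝ} (hL : 0 ≤ L) (ht : t < 0) : pairBound w m L t = 0 := by
  simp only [pairBound, box]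
  split_ifs <;> first | omega | grind

theorem pairBound_add_box_le {w : ℕ} {L : ℝ} (hL : 0 ≤ L) (hm : m ≤ w) (t : ℝ) :
    pairBound w m L t + box m (-1) (L + 1) t ≤ box (w + m) (-1) (2 * L + 2) t := by
  simp only [pairBound, box]
  split_ifs <;> first | omega | grind

theorem pairBound_reflect_add_le {w : ℕ} {L : ℝ} (hL : 0 ≤ L) (hm : m ≤ w) (t : ℝ) :
    pairBound w m L (-(t - -2)) + pairBound w m L t + box m (-L - 3) (-1) t +
      box m (-1) (L + 1) t ≤ box (w + m) (-(2 * L + 4)) (2 * L + 2) t := by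
  have h1 := pairBound_add_box_le hL hm t
  have h2 := pairBound_add_box_le hL hm (-(t - -2))
  rcases lt_or_ge t 0 with h0 | h0
  · rw [pairBound_of_neg hL h0] at h1 ⊢
    rcases lt_or_ge (-2) t with h3 | h3
    · rw [pairBound_of_neg hL (by linarith : -(t - -2) < 0)]
      simp only [box]
      split_ifs <;> first | omega | grind
    · simp only [box] at h2 ⊢
      split_ifs at h2 ⊢ <;> first | omega | grind
  · rw [pairBound_of_neg hL (by linarith : -(t - -2) < 0)]
    simp only [box] at h1 ⊢
    split_ifs at h1 ⊢ <;> first | omega | grind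

theorem Forces.quadruple (hA : IsProper A) {T w c : ℕ} {L : ℝ}
    (hT : ∀ n G, Admissible σ ω G n → #(colors A G (range n)) ≤ T)
    (h : Forces A σ ω (box w 0 L) 0 L c) (hL : 0 ≤ L) (hLσ : L + 2 < σ) (hw : w + m ≤ ω)
    (hm : m ≤ w) :
    Forces A σ ω (box (w + m) 0 (4 * L + 6)) 0 (4 * L + 6) (c + 3 * m) := by
  intro n G hG
  obtain ⟨k, H, U, V, τ, e, hH, hUn, hVn, hd, ⟨x, hx, hxm, hxc⟩, ⟨y, hy, hym, hyc⟩, hc⟩ :=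
    (h.pair hA hT hL (by linarith) hw).exists_pair hT hG
  have hcol : colors A H U = colors A H V := hxc.trans hyc.symm
  have hrep := (hx.reflect.shift (-2)).union hy hd (-1)
    (fun t ht => pairBound_of_neg hL (by linarith)) (fun t ht => pairBound_of_neg hL (by linarith))
  have hright := hym.union_right (x := fun i => shift (-2) (reflect (x i))) hcol hd
  have hleft := (hxm.reflect.shift (-2)).union_left (y := y) hcol
  have hbound := pairBound_reflect_add_le (w := w) (m := m) hL hm
  have hbox : ∀ t, box (w + m) (-(2 * L + 4)) (2 * L + 2) t ≤
      box ω (-(2 * L + 4)) (2 * L + 2) t := by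
    intro t
    unfold box
    split_ifs <;> omega
  obtain ⟨K, W, z, hat⟩ := hrep.exists_attachment hA hH m (p := -L - 3) (q := -1)
    (by linarith) (by linarith) fun t =>
      (Nat.le_add_right _ _).trans ((hbound t).trans (hbox t))
  have hfresh := hat.freshExtension e (union_subset hUn hVn)
  have hall : MeetsAllColors A K W z (-1) (L + 1) :=
    hright.attachment hat ⟨by simp only; linarith, by simp⟩
  obtain ⟨K', W', z', hat'⟩ := hat.represents.exists_attachment hA hat.admissible m (p := -1)
    (q := L + 1) (by linarith) (by linarith) fun t => (hbound t).trans (hbox t)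
  have hfresh' := hat'.freshExtension hfresh.1 hfresh.2
  have hfinal : Represents σ K' (k + m + m) W' (fun i => shift (2 * L + 4) (z' i))
      (box (w + m) 0 (4 * L + 6)) := by
    refine (hat'.represents.shift (2 * L + 4)).mono fun t => (hbound _).trans ?_
    unfold box
    split_ifs <;> first | omega | grind
  refine ⟨k + m + m, K', W', _, hfresh'.1, hat'.admissible, hfresh'.2,
    ⟨_, hfinal, .of_box hfinal, rfl⟩, ?_⟩
  rw [hat'.card_colors hall, hat.card_colors (hleft.mono (by linarith) (by linarith))]
  rw [colors_union, hxc, hyc, union_self]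
  omega

/-- After `r` rounds of at most doubling the clique number, starting from `w`, all but `2 * w` of
three times the clique number many colors are forced. -/
theorem forces_rounds (hA : IsProper A) {T w : ℕ}
    (hT : ∀ n G, Admissible σ ω G n → #(colors A G (range n)) ≤ T) (hw : w ≤ ω) (hσ : 1 < σ)
    (r : ℕ) (hr : ∀ j < r, 3 * (4 : ℝ) ^ j < σ) :
    ∃ c, c + 2 * w = 3 * min (2 ^ r * w) ω ∧
      Forces A σ ω (box (min (2 ^ r * w) ω) 0 (3 * 4 ^ r - 2)) 0 (3 * 4 ^ r - 2) c := by
  induction r with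
  | zero =>
    refine ⟨w, by rw [pow_zero, one_mul, min_eq_left hw]; omega, ?_⟩
    have := forces_clique (A := A) hA hσ hw
    rw [pow_zero, one_mul, min_eq_left hw]
    norm_num
    exact this
  | succ r ih =>
    obtain ⟨c, hc, hF⟩ := ih fun j hj => hr j (by omega)
    have hpow : 2 ^ (r + 1) * w = 2 * (2 ^ r * w) := by ring
    have h4 : (1 : ℝ) ≤ 4 ^ r := one_le_pow₀ (by norm_num)
    have hstep := hF.quadruple (m := min (2 ^ (r + 1) * w) ω - min (2 ^ r * w) ω) hA hT
      (by linarith) (by have := hr r (by omega); linarith) (by omega) (by omega)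
    have h1 : min (2 ^ r * w) ω + (min (2 ^ (r + 1) * w) ω - min (2 ^ r * w) ω) =
        min (2 ^ (r + 1) * w) ω := by omega
    have h2 : 4 * (3 * (4 : ℝ) ^ r - 2) + 6 = 3 * 4 ^ (r + 1) - 2 := by ring
    rw [h1, h2] at hstep
    exact ⟨_, by omega, hstep⟩

theorem Admissible.exists_intervals (h : Admissible σ ω G n) (A : OnlineAlg) :
    ∃ x : Fin n → ℝ × ℝ, (∀ i, 1 ≤ (x i).2 - (x i).1 ∧ (x i).2 - (x i).1 < σ) ∧
      (∀ t : ℝ, {i : Fin n | t ∈ Set.Icc (x i).1 (x i).2}.ncard ≤ ω) ∧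
      (Set.range (onlineColoring A (intervalGraph x))).ncard = #(colors A G (range n)) := by
  classical
  obtain ⟨x, lo, hi, hx⟩ := h
  refine ⟨fun i => x i, fun i => hx.length i (mem_range.2 i.2), fun t => ?_, ?_⟩
  · have h1 := hx.count t
    have h2 : box ω lo hi t ≤ ω := by
      unfold box
      split_ifs <;> omega
    refine le_trans ?_ (h1.trans h2)
    rw [← Set.ncard_image_of_injective _ Fin.val_injective, ← Set.ncard_coe_finset]
    refine Set.ncard_le_ncard ?_ (Finset.finite_toSet _)
    rintro _ ⟨i, hi, rfl⟩
    simpa using hi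
  · have hgraph : intervalGraph (fun i : Fin n => x i) = G.comap (fun j : Fin n => (j : ℕ)) := by
      ext i j
      by_cases hij : i = j
      · simp [hij]
      · have hij' : (i : ℕ) ≠ j := fun h => hij (Fin.ext h)
        have hi := hx.length i (mem_range.2 i.2)
        have hj := hx.length j (mem_range.2 j.2)
        rw [SimpleGraph.comap_adj,
          hx.adj i (mem_range.2 i.2) j (mem_range.2 j.2) hij', intervalGraph,
          SimpleGraph.fromRel_adj]
        simp only [Set.Icc_inter_Icc, Set.nonempty_Icc, Meets, sup_le_iff, le_inf_iff]
        constructor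
        · rintro ⟨-, h1 | h1⟩
          exacts [⟨h1.2.1, h1.1.2⟩, ⟨h1.1.2, h1.2.1⟩]
        · exact fun h1 => ⟨hij, Or.inl ⟨⟨by linarith, h1.2⟩, h1.1, by linarith⟩⟩
    rw [hgraph, ← Set.ncard_coe_finset]
    congr 1
    ext c
    simp only [Set.mem_range, onlineColoring_comap_val, colors, coe_image, Set.mem_image, mem_coe,
      mem_range]
    exact ⟨fun ⟨i, hi⟩ => ⟨i, i.2, hi⟩, fun ⟨i, hi, hc⟩ => ⟨⟨i, hi⟩, hc⟩⟩

/-- If `3 * 4 ^ j < σ` for all `j < r` and `ω ≤ 2 ^ r * w`, then at least `3 * ω - 2 * w` colors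
are forced. -/
theorem exists_intervals_of_rounds (hA : IsProper A) {w r : ℕ} (hw : w ≤ ω)
    (hwr : ω ≤ 2 ^ r * w) (hσ : 1 < σ) (hr : ∀ j < r, 3 * (4 : ℝ) ^ j < σ) :
    ∃ (n : ℕ) (x : Fin n → ℝ × ℝ),
      (∀ i, 1 ≤ (x i).2 - (x i).1 ∧ (x i).2 - (x i).1 < σ) ∧
      (∀ t : ℝ, {i : Fin n | t ∈ Set.Icc (x i).1 (x i).2}.ncard ≤ ω) ∧
      3 * ω ≤ (Set.range (onlineColoring A (intervalGraph x))).ncard + 2 * w := by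
  by_contra hcon
  have hlt : ∀ n G, Admissible σ ω G n → #(colors A G (range n)) + 2 * w < 3 * ω := by
    intro n G hG
    by_contra! hge
    obtain ⟨x, hlen, hclique, hcol⟩ := hG.exists_intervals A
    exact hcon ⟨n, x, hlen, hclique, by rwa [hcol]⟩
  obtain ⟨c, hc, hF⟩ := forces_rounds (A := A) (σ := σ) (ω := ω) hA (T := 3 * ω)
    (fun n G hG => by have := hlt n G hG; omega) hw hσ r hr
  have h0 : Admissible σ ω ⊥ 0 :=
    ⟨fun _ => 0, 0, 0, by simp, by simp, by simp, by simp, by simp⟩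
  obtain ⟨k, H, U, τ, -, hH, -, hgad, hcτ⟩ := hF 0 ⊥ h0
  have h1 := card_le_card hgad.subset_colors
  have h2 := hlt k H hH
  rw [min_eq_right hwr] at hc
  omega


end OnlineIntervals

theorem stmt0 (ε : ℝ) (hε : 0 < ε) (σ : ℝ) (hσ : 18 / ε ^ 2 < σ) :
    ∀ δ : ℝ, 0 < δ → ∃ ω₀ : ℕ, ∀ ω : ℕ, ω₀ ≤ ω →
      ∀ A : OnlineAlg, IsProper A →
        ∃ (n : ℕ) (x : Fin n → ℝ × ℝ),
          (∀ i, 1 ≤ (x i).2 - (x i).1 ∧ (x i).2 - (x i).1 < σ) ∧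
          (∀ t : ℝ, {i : Fin n | t ∈ Set.Icc (x i).1 (x i).2}.ncard ≤ ω) ∧
          (3 - ε - δ) * (ω : ℝ) ≤ ((Set.range (onlineColoring A (intervalGraph x))).ncard : ℝ) := by
  intro δ hδ
  obtain ⟨N, hN⟩ := exists_nat_gt (2 / δ)
  refine ⟨N + 1, fun ω hω A hA => ?_⟩
  have hωpos : (0 : ℝ) < ω := by exact_mod_cast (by omega : 0 < ω)
  have hω2 : 2 < δ * ω := by
    have h1 : (N : ℝ) ≤ ω := by exact_mod_cast (by omega : N ≤ ω)
    rw [div_lt_iff₀ hδ] at hN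
    nlinarith
  have hε2 : 0 < ε ^ 2 := by positivity
  rw [div_lt_iff₀ hε2] at hσ
  by_cases hε3 : 3 ≤ ε
  · refine ⟨0, Fin.elim0, fun i => i.elim0, fun t => ?_, ?_⟩
    · simp [Set.eq_empty_of_isEmpty]
    · have : (3 - ε - δ) * (ω : ℝ) ≤ 0 :=
        mul_nonpos_of_nonpos_of_nonneg (by linarith) hωpos.le
      exact this.trans (Nat.cast_nonneg _)
  have hσ1 : 1 < σ := by
    by_contra! h
    nlinarith
  obtain ⟨r, hr, hrσ⟩ : ∃ r : ℕ, 2 ≤ ε * 2 ^ r ∧ ∀ j < r, 3 * (4 : ℝ) ^ j < σ := by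
    by_cases h2 : 2 ≤ ε
    · exact ⟨0, by simpa using h2, by simp⟩
    · obtain ⟨r, h1, h3⟩ := exists_nat_pow_near (x := 2 / ε) (y := (2 : ℝ))
        (by rw [le_div_iff₀ hε]; linarith) (by norm_num)
      rw [le_div_iff₀ hε] at h1
      rw [div_lt_iff₀ hε] at h3
      refine ⟨r + 1, by linarith, fun j hj => ?_⟩
      have h4 : (4 : ℝ) ^ j ≤ 4 ^ r := pow_le_pow_right₀ (by norm_num) (by omega)
      have h5 : (4 : ℝ) ^ r * ε ^ 2 ≤ 4 := by
        have : (4 : ℝ) ^ r * ε ^ 2 = (2 ^ r * ε) ^ 2 := by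
          rw [mul_pow, ← pow_mul, mul_comm r 2, pow_mul]
          norm_num
        rw [this]
        have h0 : 0 ≤ 2 ^ r * ε := by positivity
        nlinarith
      by_contra! h6
      nlinarith
  have hpow : 0 < 2 ^ r := by positivity
  obtain ⟨n, x, hlen, hclique, hcol⟩ := OnlineIntervals.exists_intervals_of_rounds (ω := ω) hA
    (w := (ω + 2 ^ r - 1) / 2 ^ r) (r := r) (by
      rw [Nat.div_le_iff_le_mul_add_pred hpow]
      have := Nat.le_mul_of_pos_left ω hpow
      omega) (by
      have := Nat.lt_mul_div_succ (ω + 2 ^ r - 1) hpow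
      rw [mul_add] at this
      omega) hσ1 hrσ
  refine ⟨n, x, hlen, hclique, ?_⟩
  have hw : 2 ^ r * ((ω + 2 ^ r - 1) / 2 ^ r) ≤ ω + 2 ^ r :=
    (Nat.mul_div_le _ _).trans (by omega)
  generalize (ω + 2 ^ r - 1) / 2 ^ r = w at hw hcol
  have hw' : (2 : ℝ) ^ r * w ≤ ω + 2 ^ r := by exact_mod_cast hw
  have hcol' : (3 : ℝ) * ω ≤
      ((Set.range (onlineColoring A (intervalGraph x))).ncard : ℝ) + 2 * w := by
    exact_mod_cast hcol
  have hpow' : (0 : ℝ) < 2 ^ r := by positivity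
  have hw2 : 2 * (w : ℝ) ≤ ε * ω + 2 := by
    have : 2 ^ r * (2 * (w : ℝ)) ≤ 2 ^ r * (ε * ω + 2) := by nlinarith
    exact le_of_mul_le_mul_left this hpow'
  linarith
end

section
/- For every ε > 0 and every real σ > 27/ε² the following holds: for every δ > 0 there exists ω₀ ∈ ℕ such that for every integer ω ≥ ω₀ and every proper deterministic online coloring algorithm A with unknown representation, there exists a finite sequence of closed intervals in ℝ, each of length at least 1 and less than σ, whose clique number is at most ω, such that when the associated interval graph is presented to A vertex by vertex in the order of the sequence, A uses at least (3 − ε − δ)·ω colors. -/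
open Finset

/-- The color that `A` gives to the vertex `i` of a graph on `ℕ` presented in the natural order. -/
def vertexColor (A : OnlineAlg) (G : SimpleGraph ℕ) (i : ℕ) : ℕ :=
  A i (G.comap (Fin.val : Fin (i + 1) → ℕ))

lemma vertexColor_congr (A : OnlineAlg) {G H : SimpleGraph ℕ} {n i : ℕ} (hi : i < n)
    (h : ∀ a < n, ∀ b < n, (H.Adj a b ↔ G.Adj a b)) : vertexColor A H i = vertexColor A G i := by
  unfold vertexColor
  congr 1
  ext a b
  exact h a (by omega) b (by omega)

lemma image_vertexColor_congr (A : OnlineAlg) {G H : SimpleGraph ℕ} {n : ℕ} {S : Finset ℕ}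
    (hS : ∀ i ∈ S, i < n) (h : ∀ a < n, ∀ b < n, (H.Adj a b ↔ G.Adj a b)) :
    S.image (vertexColor A H) = S.image (vertexColor A G) :=
  image_congr fun i hi => vertexColor_congr A (hS i hi) h

lemma IsProper.vertexColor_ne {A : OnlineAlg} (hA : IsProper A) {G : SimpleGraph ℕ} {i j : ℕ}
    (h : G.Adj i j) : vertexColor A G i ≠ vertexColor A G j :=
  hA (max i j + 1) (G.comap Fin.val) ⟨i, by omega⟩ ⟨j, by omega⟩ h

lemma IsProper.disjoint_image {A : OnlineAlg} (hA : IsProper A) {G : SimpleGraph ℕ}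
    {S T : Finset ℕ} (h : ∀ a ∈ S, ∀ b ∈ T, G.Adj a b) :
    Disjoint (S.image (vertexColor A G)) (T.image (vertexColor A G)) := by
  rw [disjoint_left]
  intro c hc hc'
  obtain ⟨a, ha, rfl⟩ := mem_image.1 hc
  obtain ⟨b, hb, hab⟩ := mem_image.1 hc'
  exact hA.vertexColor_ne (h a ha b hb) hab.symm

lemma IsProper.card_image_clique {A : OnlineAlg} (hA : IsProper A) {G : SimpleGraph ℕ}
    {S : Finset ℕ} (h : ∀ a ∈ S, ∀ b ∈ S, a ≠ b → G.Adj a b) :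
    (S.image (vertexColor A G)).card = S.card :=
  card_image_of_injOn fun a ha b hb hab => by
    by_contra hne
    exact hA.vertexColor_ne (h a ha b hb hne) hab

/-- The vertices `S` of `G` are represented by intervals in `[0, W]` with lengths in `[1, L]`,
at most `k` of them sharing a point. -/
def HasRep (G : SimpleGraph ℕ) (S : Finset ℕ) (k : ℕ) (L W : ℝ) : Prop :=
  ∃ l r : ℕ → ℝ,
    (∀ i ∈ S, 0 ≤ l i ∧ r i ≤ W ∧ 1 ≤ r i - l i ∧ r i - l i ≤ L) ∧
    (∀ i ∈ S, ∀ j ∈ S, i ≠ j → (G.Adj i j ↔ l i ≤ r j ∧ l j ≤ r i)) ∧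
    ∀ t : ℝ, #{i ∈ S | l i ≤ t ∧ t ≤ r i} ≤ k

/-- The vertices `S` of `G` are represented by intervals in `[0, W]` with lengths in `[1, L]`,
at most `k` of them sharing a point; the intervals that start at `0` are those of `E`,
the ones that end at `W` are those of `F`. -/
def HasRepEnds (G : SimpleGraph ℕ) (S E F : Finset ℕ) (k : ℕ) (L W : ℝ) : Prop :=
  ∃ l r : ℕ → ℝ,
    (∀ i ∈ S, 0 ≤ l i ∧ r i ≤ W ∧ 1 ≤ r i - l i ∧ r i - l i ≤ L) ∧
    (∀ i ∈ S, (l i = 0 ↔ i ∈ E) ∧ (r i = W ↔ i ∈ F)) ∧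
    (∀ i ∈ S, ∀ j ∈ S, i ≠ j → (G.Adj i j ↔ l i ≤ r j ∧ l j ≤ r i)) ∧
    ∀ t : ℝ, #{i ∈ S | l i ≤ t ∧ t ≤ r i} ≤ k

section Representations

variable {G H : SimpleGraph ℕ} {S T E F E' F' B : Finset ℕ} {j k k' n : ℕ} {L W W' : ℝ}

lemma HasRepEnds.hasRep (h : HasRepEnds G S E F k L W) : HasRep G S k L W := by
  obtain ⟨l, r, h₁, -, h₂, h₃⟩ := h
  exact ⟨l, r, h₁, h₂, h₃⟩

lemma HasRep.mono (h : HasRep G S k L W) (hT : T ⊆ S) (hk : k ≤ k') (hW : W ≤ W') :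
    HasRep G T k' L W' := by
  obtain ⟨l, r, h₁, h₂, h₃⟩ := h
  refine ⟨l, r, fun i hi => ?_, fun i hi j hj => h₂ i (hT hi) j (hT hj), fun t => ?_⟩
  · obtain ⟨h, h', h''⟩ := h₁ i (hT hi)
    exact ⟨h, h'.trans hW, h''⟩
  · exact (card_le_card (filter_subset_filter _ hT)).trans ((h₃ t).trans hk)

lemma HasRep.congr (h : HasRep G S k L W) (hS : ∀ i ∈ S, i < n)
    (hGH : ∀ a < n, ∀ b < n, (H.Adj a b ↔ G.Adj a b)) : HasRep H S k L W := by
  obtain ⟨l, r, h₁, h₂, h₃⟩ := h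
  exact ⟨l, r, h₁, fun i hi j hj hij => (hGH i (hS i hi) j (hS j hj)).trans (h₂ i hi j hj hij), h₃⟩

lemma hasRep_clique (hS : ∀ a ∈ S, ∀ b ∈ S, a ≠ b → G.Adj a b) (hk : S.card ≤ k) (hL : 1 ≤ L) :
    HasRep G S k L 1 := by
  refine ⟨0, 1, fun i _ => ?_, fun i hi j hj hij => ?_, fun t => (card_filter_le _ _).trans hk⟩
  · simpa using hL
  · simpa using hS i hi j hj hij

/-- Two representations placed next to each other so that they share an endpoint. -/
lemma HasRepEnds.glue (hS : HasRepEnds G S E F k L W) (hT : HasRepEnds G T E' F' k L W')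
    (hW : 0 < W) (hW' : 0 < W') (hE : E ⊆ S) (hF' : F' ⊆ T)
    (hST : Disjoint S T) (hcard : F.card + E'.card ≤ k)
    (hadj : ∀ a ∈ S, ∀ b ∈ T, (G.Adj a b ↔ a ∈ F ∧ b ∈ E')) :
    HasRepEnds G (S ∪ T) E F' k L (W + W') := by
  obtain ⟨l, r, h₁, h₂, h₃, h₄⟩ := hS
  obtain ⟨l', r', h₁', h₂', h₃', h₄'⟩ := hT
  have hTS : ∀ i ∈ T, i ∉ S := fun i hi hi' => disjoint_left.1 hST hi' hi
  have hcross : ∀ a ∈ S, ∀ b ∈ T, (G.Adj a b ↔ l a ≤ W + r' b ∧ W + l' b ≤ r a) := by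
    intro a ha b hb
    rw [hadj a ha b hb, ← (h₂ a ha).2, ← (h₂' b hb).1]
    obtain ⟨p, q, u, -⟩ := h₁ a ha
    obtain ⟨p', q', u', -⟩ := h₁' b hb
    constructor
    · rintro ⟨e, e'⟩
      constructor <;> linarith
    · rintro ⟨-, e⟩
      constructor <;> linarith
  refine ⟨fun i => if i ∈ S then l i else W + l' i, fun i => if i ∈ S then r i else W + r' i,
    fun i hi => ?_, fun i hi => ?_, fun i hi j hj hij => ?_, fun t => ?_⟩
  · rcases mem_union.1 hi with hi | hi
    · obtain ⟨p, q, u, v⟩ := h₁ i hi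
      simp only [hi, if_true]
      exact ⟨p, by linarith, u, v⟩
    · obtain ⟨p, q, u, v⟩ := h₁' i hi
      simp only [hTS i hi, if_false]
      exact ⟨by linarith, by linarith, by linarith, by linarith⟩
  · rcases mem_union.1 hi with hi | hi
    · obtain ⟨p, q, u, v⟩ := h₁ i hi
      simp only [hi, if_true]
      refine ⟨(h₂ i hi).1, iff_of_false (by linarith) fun h => hTS i (hF' h) hi⟩
    · obtain ⟨p, q, u, v⟩ := h₁' i hi
      simp only [hTS i hi, if_false]
      refine ⟨iff_of_false (by linarith) fun h => hTS i hi (hE h), ?_⟩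
      rw [← (h₂' i hi).2, add_right_inj]
  · rcases mem_union.1 hi with hi | hi <;> rcases mem_union.1 hj with hj | hj
    · simpa only [hi, hj, if_true] using h₃ i hi j hj hij
    · simpa only [hi, hTS j hj, if_true, if_false] using hcross i hi j hj
    · simpa only [hTS i hi, hj, if_true, if_false, G.adj_comm i j, and_comm] using hcross j hj i hi
    · simpa only [hTS i hi, hTS j hj, if_false, add_le_add_iff_left] using h₃' i hi j hj hij
  · rcases lt_trichotomy t W with ht | rfl | ht
    · refine (card_le_card fun i hi => ?_).trans (h₄ t)
      obtain ⟨hi, hi'⟩ := mem_filter.1 hi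
      rcases mem_union.1 hi with hi | hi
      · simp only [hi, if_true] at hi'
        exact mem_filter.2 ⟨hi, hi'⟩
      · simp only [hTS i hi, if_false] at hi'
        linarith [h₁' i hi]
    · refine (card_le_card (t := F ∪ E') fun i hi => ?_).trans ((card_union_le _ _).trans hcard)
      obtain ⟨hi, hi'⟩ := mem_filter.1 hi
      rcases mem_union.1 hi with hi | hi
      · simp only [hi, if_true] at hi'
        exact mem_union_left _ ((h₂ i hi).2.1 (by linarith [h₁ i hi]))
      · simp only [hTS i hi, if_false] at hi'
        exact mem_union_right _ ((h₂' i hi).1.1 (by linarith [h₁' i hi]))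
    · refine (card_le_card fun i hi => ?_).trans (h₄' (t - W))
      obtain ⟨hi, hi'⟩ := mem_filter.1 hi
      rcases mem_union.1 hi with hi | hi
      · simp only [hi, if_true] at hi'
        linarith [h₁ i hi]
      · simp only [hTS i hi, if_false] at hi'
        exact mem_filter.2 ⟨hi, by linarith, by linarith⟩

/-- A clique `B` of intervals spanning a represented set. -/
lemma HasRep.cell (hS : HasRep G S j L W) (hSB : Disjoint S B) (hB : B.card ≤ j)
    (hW : 0 ≤ W) (hL : W + 2 ≤ L)
    (hadj : ∀ a ∈ S, ∀ b ∈ B, G.Adj a b) (hBB : ∀ a ∈ B, ∀ b ∈ B, a ≠ b → G.Adj a b) :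
    HasRepEnds G (S ∪ B) B B (2 * j) L (W + 2) := by
  obtain ⟨l, r, h₁, h₂, h₃⟩ := hS
  have hS : ∀ i ∈ S, i ∉ B := fun i hi => disjoint_left.1 hSB hi
  refine ⟨fun i => if i ∈ B then 0 else l i + 1, fun i => if i ∈ B then W + 2 else r i + 1,
    fun i hi => ?_, fun i hi => ?_, fun i hi j hj hij => ?_, fun t => ?_⟩
  · rcases mem_union.1 hi with hi | hi
    · obtain ⟨p, q, u, v⟩ := h₁ i hi
      simp only [hS i hi, if_false]
      exact ⟨by linarith, by linarith, by linarith, by linarith⟩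
    · simp only [hi, if_true]
      exact ⟨le_rfl, le_rfl, by linarith, by linarith⟩
  · rcases mem_union.1 hi with hi | hi
    · obtain ⟨p, q, -⟩ := h₁ i hi
      simp only [hS i hi, if_false, iff_false]
      exact ⟨by linarith, fun h => by linarith⟩
    · simp [hi]
  · rcases mem_union.1 hi with hi | hi <;> rcases mem_union.1 hj with hj | hj
    · simpa [hS i hi, hS j hj] using h₂ i hi j hj hij
    · have := h₁ i hi
      simp only [hS i hi, hj, hadj i hi j hj, if_true, if_false, true_iff]
      constructor <;> linarith
    · have := h₁ j hj
      simp only [hS j hj, hi, (hadj j hj i hi).symm, if_true, if_false, true_iff]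
      constructor <;> linarith
    · simp only [hi, hj, hBB i hi j hj hij, if_true, true_iff]
      constructor <;> linarith
  · refine (card_le_card (t := {i ∈ S | l i ≤ t - 1 ∧ t - 1 ≤ r i} ∪ B) fun i hi => ?_).trans
      ((card_union_le _ _).trans (by linarith [h₃ (t - 1)]))
    obtain ⟨hi, hi'⟩ := mem_filter.1 hi
    rcases mem_union.1 hi with hi | hi
    · simp only [hS i hi, if_false] at hi'
      exact mem_union_left _ (mem_filter.2 ⟨hi, by linarith, by linarith⟩)
    · exact mem_union_right _ hi

/-- Adding margins on both sides. -/
lemma HasRep.hasRepEnds_empty (h : HasRep G S k L W) : HasRepEnds G S ∅ ∅ k L (W + 2) := by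
  obtain ⟨l, r, h₁, h₂, h₃⟩ := h
  refine ⟨fun i => l i + 1, fun i => r i + 1, fun i hi => ?_, fun i hi => ?_,
    fun i hi j hj hij => ?_, fun t => ?_⟩
  · obtain ⟨p, q, u, v⟩ := h₁ i hi
    exact ⟨by linarith, by linarith, by linarith, by linarith⟩
  · obtain ⟨p, q, -⟩ := h₁ i hi
    simp only [notMem_empty, iff_false]
    exact ⟨by linarith, fun h => by linarith⟩
  · simp [h₂ i hi j hj hij]
  · convert h₃ (t - 1) using 4 with i
    · exact le_sub_iff_add_le.symm
    · exact sub_le_iff_le_add.symm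

/-- Two representations placed apart. -/
lemma HasRep.union (hS : HasRep G S k L W) (hT : HasRep G T k L W') (hST : Disjoint S T)
    (hadj : ∀ a ∈ S, ∀ b ∈ T, ¬ G.Adj a b) : ∃ W'', HasRep G (S ∪ T) k L W'' := by
  have h := (hS.mono Subset.rfl le_rfl (le_max_left W 0)).hasRepEnds_empty
  have h' := (hT.mono Subset.rfl le_rfl (le_max_left W' 0)).hasRepEnds_empty
  exact ⟨_, (h.glue h' (by positivity) (by positivity) (empty_subset _) (empty_subset _) hST
    (by simp) (by simpa using hadj)).hasRep⟩

end Representations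

/-- A stage of the game: the first `size` vertices of `graph` have been presented. -/
structure Position where
  size : ℕ
  graph : SimpleGraph ℕ

namespace Position

/-- `q` continues `p`, and no vertex presented after `p` is adjacent to a vertex of `p`. -/
def Ext (p q : Position) : Prop :=
  p.size ≤ q.size ∧
    (∀ a < p.size, ∀ b < p.size, (q.graph.Adj a b ↔ p.graph.Adj a b)) ∧
    ∀ a < p.size, ∀ b, p.size ≤ b → b < q.size → ¬ q.graph.Adj a b

/-- The presented graph has a representation with lengths in `[1, L]` and clique number at
most `ω`. -/
def Good (ω : ℕ) (L : ℝ) (p : Position) : Prop :=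
  ∃ W, HasRep p.graph (range p.size) ω L W

/-- `q` continues `p` apart from it, `U` is a union of components of `q` not meeting `p`, and
the remaining vertices of `q` have a representation. -/
def Fresh (ω : ℕ) (L : ℝ) (p q : Position) (U : Finset ℕ) : Prop :=
  p.Ext q ∧ U ⊆ Ico p.size q.size ∧ (∀ a ∈ U, ∀ b < q.size, b ∉ U → ¬ q.graph.Adj a b) ∧
    ∃ W, HasRep q.graph (range q.size \ U) ω L W

/-- Present a clique of `j` new vertices whose earlier neighbors are those in `T`. -/
def addClique (p : Position) (j : ℕ) (T : Finset ℕ) : Position where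
  size := p.size + j
  graph := SimpleGraph.fromRel fun a b =>
    (a < p.size ∧ b < p.size ∧ p.graph.Adj a b) ∨ (p.size ≤ a ∧ (b ∈ T ∨ p.size ≤ b))

/-- The vertices presented in `addClique`. -/
def newClique (p : Position) (j : ℕ) : Finset ℕ := Ico p.size (p.size + j)

variable {p q s : Position} {ω j k : ℕ} {L W : ℝ} {T U V B : Finset ℕ} {a b : ℕ}

lemma Ext.refl (p : Position) : p.Ext p :=
  ⟨le_rfl, fun _ _ _ _ => Iff.rfl, fun _ _ _ h h' => absurd h' (by omega)⟩

lemma Ext.trans (h : p.Ext q) (h' : q.Ext s) : p.Ext s := by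
  obtain ⟨h₁, h₂, h₃⟩ := h
  obtain ⟨h₁', h₂', h₃'⟩ := h'
  refine ⟨h₁.trans h₁', fun a ha b hb => ?_, fun a ha b hb hb' => ?_⟩
  · rw [h₂' a (by omega) b (by omega), h₂ a ha b hb]
  · by_cases hbq : b < q.size
    · rw [h₂' a (by omega) b hbq]
      exact h₃ a ha b hb hbq
    · exact h₃' a (by omega) b (by omega) hb'

lemma Fresh.of_ext (h : p.Ext q) (h' : Fresh ω L q s U) : Fresh ω L p s U := by
  obtain ⟨h₁, h₂, h₃⟩ := h'
  exact ⟨h.trans h₁, h₂.trans (Ico_subset_Ico_left h.1), h₃⟩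

lemma Fresh.trans (h : Fresh ω L p q U) (h' : Fresh ω L q s V) : Fresh ω L p s (U ∪ V) := by
  obtain ⟨h₁, h₂, h₃, -⟩ := h
  obtain ⟨h₁', h₂', h₃', W, hW⟩ := h'
  refine ⟨h₁.trans h₁', union_subset (h₂.trans (Ico_subset_Ico_right h₁'.1))
    (h₂'.trans (Ico_subset_Ico_left h₁.1)), fun a ha b hb hbUV => ?_,
    W, hW.mono (sdiff_subset_sdiff Subset.rfl subset_union_right) le_rfl le_rfl⟩
  rw [mem_union, not_or] at hbUV
  rcases mem_union.1 ha with ha | ha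
  · have haq : a < q.size := (mem_Ico.1 (h₂ ha)).2
    by_cases hbq : b < q.size
    · rw [h₁'.2.1 a haq b hbq]
      exact h₃ a ha b hbq hbUV.1
    · exact h₁'.2.2 a haq b (by omega) hb
  · exact h₃' a ha b hb hbUV.2

lemma Fresh.lt_size (h : Fresh ω L p q U) (ha : a ∈ U) : a < q.size := (mem_Ico.1 (h.2.1 ha)).2

lemma Fresh.size_le (h : Fresh ω L p q U) (ha : a ∈ U) : p.size ≤ a := (mem_Ico.1 (h.2.1 ha)).1

lemma Fresh.good (h : Fresh ω L p q U) (hU : HasRep q.graph U k L W) (hk : k ≤ ω) :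
    q.Good ω L := by
  have hlt := fun a => h.lt_size (a := a)
  obtain ⟨-, -, h₃, W', hW'⟩ := h
  have := (hU.mono Subset.rfl hk le_rfl).union hW' disjoint_sdiff fun a ha b hb =>
    h₃ a ha b (mem_range.1 (mem_sdiff.1 hb).1) (mem_sdiff.1 hb).2
  rwa [union_sdiff_of_subset fun a ha => mem_range.2 (hlt a ha)] at this

lemma Good.fresh_empty (h : p.Good ω L) : Fresh ω L p p ∅ :=
  ⟨Ext.refl p, by simp, by simp, by simpa [Good] using h⟩

@[simp] lemma size_addClique : (p.addClique j T).size = p.size + j := rfl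

@[simp] lemma card_newClique : (p.newClique j).card = j := by simp [newClique]

lemma addClique_adj_of_lt (ha : a < p.size) (hb : b < p.size) :
    (p.addClique j T).graph.Adj a b ↔ p.graph.Adj a b := by
  have := p.graph.adj_comm a b
  have := p.graph.ne_of_adj (a := a) (b := b)
  simp only [addClique, SimpleGraph.fromRel_adj]
  grind

lemma addClique_adj_newClique (ha : a < p.size) (hb : b ∈ p.newClique j) :
    (p.addClique j T).graph.Adj a b ↔ a ∈ T := by
  have hb := (mem_Ico.1 hb).1
  simp only [addClique, SimpleGraph.fromRel_adj]
  grind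

lemma newClique_adj (ha : a ∈ p.newClique j) (hb : b ∈ p.newClique j) (hab : a ≠ b) :
    (p.addClique j T).graph.Adj a b := by
  have ha := (mem_Ico.1 ha).1
  have hb := (mem_Ico.1 hb).1
  simp only [addClique, SimpleGraph.fromRel_adj]
  grind

lemma Fresh.addClique (h : Fresh ω L p q U) (hT : T ⊆ U) :
    Fresh ω L p (q.addClique j T) (U ∪ q.newClique j) := by
  have hlt := fun a => h.lt_size (a := a)
  have hle := fun a => h.size_le (a := a)
  obtain ⟨h₁, h₂, h₃, W, hW⟩ := h
  obtain ⟨h₁₁, h₁₂, h₁₃⟩ := h₁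
  have hnew : ∀ b, b ∈ q.newClique j ↔ q.size ≤ b ∧ b < q.size + j := fun b => mem_Ico
  refine ⟨⟨by simp; omega, fun a ha b hb => ?_, fun a ha b hb hb' => ?_⟩, ?_,
    fun a ha b hb hbU => ?_, W, ?_⟩
  · rw [addClique_adj_of_lt (by omega) (by omega), h₁₂ a ha b hb]
  · by_cases hbq : b < q.size
    · rw [addClique_adj_of_lt (by omega) hbq]
      exact h₁₃ a ha b hb hbq
    · rw [addClique_adj_newClique (by omega) ((hnew b).2 ⟨by omega, hb'⟩)]
      exact fun haT => absurd (hle a (hT haT)) (by omega)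
  · intro a ha
    rw [mem_Ico, size_addClique]
    rcases mem_union.1 ha with ha | ha
    · have := hlt a ha
      have := hle a ha
      omega
    · have := (hnew a).1 ha
      omega
  · rw [mem_union, not_or, hnew] at hbU
    have hbq : b < q.size := by
      rw [size_addClique] at hb
      omega
    rcases mem_union.1 ha with ha | ha
    · rw [addClique_adj_of_lt (hlt a ha) hbq]
      exact h₃ a ha b hbq hbU.1
    · rw [SimpleGraph.adj_comm, addClique_adj_newClique hbq ha]
      exact fun hbT => hbU.1 (hT hbT)
  · refine (hW.congr (n := q.size) (fun i hi => mem_range.1 (mem_sdiff.1 hi).1)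
      fun a ha b hb => addClique_adj_of_lt ha hb).mono (fun a ha => ?_) le_rfl le_rfl
    simp only [mem_sdiff, mem_range, mem_union, size_addClique, hnew] at ha ⊢
    refine ⟨?_, ?_⟩
    · omega
    · tauto

end Position

/-- A finite set of outcomes, one of which is always available, contains an outcome that
remains available forever from some point on. -/
lemma exists_persistent_outcome {X Y : Type*} {R : X → X → Prop} {P : X → Prop}
    {D : X → Y → Prop} (hrefl : ∀ p, R p p) (htrans : ∀ p q s, R p q → R q s → R p s)
    (hD : ∀ p q y, R p q → D q y → D p y) (F : Finset Y) (p : X) (hp : P p)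
    (h : ∀ q, R p q → P q → ∃ y ∈ F, D q y) :
    ∃ y ∈ F, ∃ q, R p q ∧ P q ∧ ∀ s, R q s → P s → D s y := by
  classical
  induction F using Finset.induction_on generalizing p with
  | empty => simpa using h p (hrefl p) hp
  | insert y F _ ih =>
    by_cases hy : ∀ q, R p q → P q → D q y
    · exact ⟨y, mem_insert_self y F, p, hrefl p, hp, hy⟩
    · push Not at hy
      obtain ⟨q, hpq, hq, hqy⟩ := hy
      obtain ⟨z, hz, s, hqs, hs⟩ := ih q hq fun s hqs hs => by
        obtain ⟨z, hz, hsz⟩ := h s (htrans _ _ _ hpq hqs) hs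
        rcases mem_insert.1 hz with rfl | hz
        · exact absurd (hD _ _ _ hqs hsz) hqy
        · exact ⟨z, hz, hsz⟩
      exact ⟨z, mem_insert_of_mem hz, s, htrans _ _ _ hpq hqs, hs⟩

section Strategy

open Position

/-- From `p` the adversary can present a new component with the color set `C` that is
represented in `[0, W]` with clique number at most `k`. -/
def CanForce (A : OnlineAlg) (ω : ℕ) (L : ℝ) (k : ℕ) (W : ℝ) (p : Position) (C : Finset ℕ) :
    Prop :=
  ∃ q U, Fresh ω L p q U ∧ HasRep q.graph U k L W ∧ U.image (vertexColor A q.graph) = C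

/-- From `p` the adversary can present a part with the color set `C` as in `CanForce`,
together with a clique of `k` vertices joined to it that has the color set `D`. -/
def CanForceCell (A : OnlineAlg) (ω : ℕ) (L : ℝ) (k : ℕ) (W : ℝ) (C : Finset ℕ) (p : Position)
    (D : Finset ℕ) : Prop :=
  ∃ q U B, Fresh ω L p q (U ∪ B) ∧ HasRep q.graph U k L W ∧
    U.image (vertexColor A q.graph) = C ∧ B.image (vertexColor A q.graph) = D ∧
    Disjoint U B ∧ B.card = k ∧ (∀ a ∈ U, ∀ b ∈ B, q.graph.Adj a b) ∧
    ∀ a ∈ B, ∀ b ∈ B, a ≠ b → q.graph.Adj a b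

variable {A : OnlineAlg} {ω k c : ℕ} {L W : ℝ} {C D : Finset ℕ} {p q : Position}

lemma CanForce.of_ext (h : p.Ext q) (hq : CanForce A ω L k W q C) : CanForce A ω L k W p C := by
  obtain ⟨s, U, hU, h'⟩ := hq
  exact ⟨s, U, hU.of_ext h, h'⟩

lemma CanForceCell.of_ext (h : p.Ext q) (hq : CanForceCell A ω L k W C q D) :
    CanForceCell A ω L k W C p D := by
  obtain ⟨s, U, B, hU, h'⟩ := hq
  exact ⟨s, U, B, hU.of_ext h, h'⟩

lemma CanForce.cell (h : CanForce A ω L k W p C) : ∃ D, CanForceCell A ω L k W C p D := by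
  obtain ⟨q, U, hU, hrep, hC⟩ := h
  have hlt : ∀ a ∈ U, a < q.size := fun a ha => hU.lt_size ha
  have hadj : ∀ a < q.size, ∀ b < q.size,
      ((q.addClique k U).graph.Adj a b ↔ q.graph.Adj a b) :=
    fun a ha b hb => addClique_adj_of_lt ha hb
  refine ⟨_, q.addClique k U, U, q.newClique k, hU.addClique Subset.rfl, hrep.congr hlt hadj,
    ?_, rfl, ?_, card_newClique, fun a ha b hb => ?_, fun a ha b hb => newClique_adj ha hb⟩
  · rw [image_vertexColor_congr A hlt hadj, hC]
  · rw [disjoint_left]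
    intro a ha ha'
    have := hlt a ha
    have := (mem_Ico.1 ha').1
    omega
  · exact (addClique_adj_newClique (hlt a ha) hb).2 ha

lemma canForce_clique (hA : IsProper A) (hp : p.Good ω L) (hL : 1 ≤ L) :
    ∃ C : Finset ℕ, C.card = k ∧ CanForce A ω L k 1 p C := by
  have hclique : ∀ a ∈ ∅ ∪ p.newClique k, ∀ b ∈ ∅ ∪ p.newClique k, a ≠ b →
      (p.addClique k ∅).graph.Adj a b := by
    rw [empty_union]
    exact fun a ha b hb => newClique_adj ha hb
  refine ⟨_, ?_, _, _, hp.fresh_empty.addClique Subset.rfl,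
    hasRep_clique hclique (by simp) hL, rfl⟩
  rw [hA.card_image_clique hclique, empty_union, card_newClique]

/-- Four parts with equal color sets, the first and the last of them spanned by cliques with
equal color sets, are joined by a path of cliques. -/
lemma canForce_join (hA : IsProper A) (hW : 0 ≤ W) (hL : W + 2 ≤ L) (hcC : c ≤ C.card)
    {p₁ p₂ p₃ p₄ p₅ : Position} {S₀ B₀ S₁ S₂ S₃ B₃ : Finset ℕ}
    (h₂ : Fresh ω L p₁ p₂ (S₀ ∪ B₀)) (hrep₀ : HasRep p₂.graph S₀ k L W)
    (hC₀ : S₀.image (vertexColor A p₂.graph) = C) (hD₀ : B₀.image (vertexColor A p₂.graph) = D)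
    (hd₀ : Disjoint S₀ B₀) (hB₀ : B₀.card = k) (hSB₀ : ∀ a ∈ S₀, ∀ b ∈ B₀, p₂.graph.Adj a b)
    (hBB₀ : ∀ a ∈ B₀, ∀ b ∈ B₀, a ≠ b → p₂.graph.Adj a b)
    (h₃ : Fresh ω L p₂ p₃ S₁) (hrep₁ : HasRep p₃.graph S₁ k L W)
    (hC₁ : S₁.image (vertexColor A p₃.graph) = C)
    (h₄ : Fresh ω L p₃ p₄ S₂) (hrep₂ : HasRep p₄.graph S₂ k L W)
    (hC₂ : S₂.image (vertexColor A p₄.graph) = C)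
    (h₅ : Fresh ω L p₄ p₅ (S₃ ∪ B₃)) (hrep₃ : HasRep p₅.graph S₃ k L W)
    (hD₃ : B₃.image (vertexColor A p₅.graph) = D)
    (hd₃ : Disjoint S₃ B₃) (hB₃ : B₃.card = k) (hSB₃ : ∀ a ∈ S₃, ∀ b ∈ B₃, p₅.graph.Adj a b)
    (hBB₃ : ∀ a ∈ B₃, ∀ b ∈ B₃, a ≠ b → p₅.graph.Adj a b) :
    ∃ C : Finset ℕ, c + 3 * k ≤ C.card ∧ CanForce A ω L (2 * k) (4 * (W + 2)) p₁ C := by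
  set p₆ := p₅.addClique k (B₀ ∪ S₁) with hp₆
  set B₁ := p₅.newClique k with hB₁
  set p₇ := p₆.addClique k (B₁ ∪ (S₂ ∪ B₃)) with hp₇
  set B₂ := p₆.newClique k with hB₂
  have e₂₅ : p₂.Ext p₅ := h₃.1.trans (h₄.1.trans h₅.1)
  have e₃₅ : p₃.Ext p₅ := h₄.1.trans h₅.1
  have e₄₅ : p₄.Ext p₅ := h₅.1
  have n₂₃ := h₃.1.1
  have n₃₄ := h₄.1.1
  have n₄₅ := h₅.1.1
  have hfresh : Fresh ω L p₁ p₇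
      ((((S₀ ∪ B₀) ∪ S₁) ∪ S₂) ∪ (S₃ ∪ B₃) ∪ B₁ ∪ B₂) :=
    ((((h₂.trans h₃).trans h₄).trans h₅)).addClique (by grind)
      |>.addClique (by grind)
  have a₅₇ : ∀ a < p₅.size, ∀ b < p₅.size, (p₇.graph.Adj a b ↔ p₅.graph.Adj a b) := by
    intro a ha b hb
    rw [hp₇, addClique_adj_of_lt (by rw [hp₆, size_addClique]; omega)
      (by rw [hp₆, size_addClique]; omega), hp₆, addClique_adj_of_lt ha hb]
  have a₂₇ : ∀ a < p₂.size, ∀ b < p₂.size, (p₇.graph.Adj a b ↔ p₂.graph.Adj a b) :=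
    fun a ha b hb => (a₅₇ a (by omega) b (by omega)).trans (e₂₅.2.1 a ha b hb)
  have a₃₇ : ∀ a < p₃.size, ∀ b < p₃.size, (p₇.graph.Adj a b ↔ p₃.graph.Adj a b) :=
    fun a ha b hb => (a₅₇ a (by omega) b (by omega)).trans (e₃₅.2.1 a ha b hb)
  have a₄₇ : ∀ a < p₄.size, ∀ b < p₄.size, (p₇.graph.Adj a b ↔ p₄.graph.Adj a b) :=
    fun a ha b hb => (a₅₇ a (by omega) b (by omega)).trans (e₄₅.2.1 a ha b hb)
  have f₂ : ∀ a < p₂.size, ∀ b, p₂.size ≤ b → b < p₅.size → ¬ p₇.graph.Adj a b :=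
    fun a ha b hb hb' => by
      rw [a₅₇ a (by omega) b hb']
      exact e₂₅.2.2 a ha b hb hb'
  have f₃ : ∀ a < p₃.size, ∀ b, p₃.size ≤ b → b < p₅.size → ¬ p₇.graph.Adj a b :=
    fun a ha b hb hb' => by
      rw [a₅₇ a (by omega) b hb']
      exact e₃₅.2.2 a ha b hb hb'
  have f₄ : ∀ a < p₄.size, ∀ b, p₄.size ≤ b → b < p₅.size → ¬ p₇.graph.Adj a b :=
    fun a ha b hb hb' => by
      rw [a₅₇ a (by omega) b hb']
      exact e₄₅.2.2 a ha b hb hb'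
  have mB₁ : ∀ b ∈ B₁, p₅.size ≤ b ∧ b < p₆.size := fun b hb => mem_Ico.1 hb
  have mB₂ : ∀ b ∈ B₂, p₆.size ≤ b := fun b hb => (mem_Ico.1 hb).1
  have n₅₆ : p₅.size ≤ p₆.size := by
    rw [hp₆, size_addClique]
    omega
  have g₁ : ∀ a < p₅.size, ∀ b ∈ B₁, (p₇.graph.Adj a b ↔ a ∈ B₀ ∪ S₁) := fun a ha b hb => by
    rw [hp₇, addClique_adj_of_lt (by omega) (mB₁ b hb).2, hp₆, addClique_adj_newClique ha hb]
  have g₂ : ∀ a < p₆.size, ∀ b ∈ B₂, (p₇.graph.Adj a b ↔ a ∈ B₁ ∪ (S₂ ∪ B₃)) :=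
    fun a ha b hb => addClique_adj_newClique ha hb
  have mS₀ : ∀ a ∈ S₀, a < p₂.size := fun a ha => h₂.lt_size (mem_union_left _ ha)
  have mB₀ : ∀ a ∈ B₀, a < p₂.size := fun a ha => h₂.lt_size (mem_union_right _ ha)
  have mS₁ : ∀ a ∈ S₁, p₂.size ≤ a ∧ a < p₃.size := fun a ha => ⟨h₃.size_le ha, h₃.lt_size ha⟩
  have mS₂ : ∀ a ∈ S₂, p₃.size ≤ a ∧ a < p₄.size := fun a ha => ⟨h₄.size_le ha, h₄.lt_size ha⟩
  have mS₃ : ∀ a ∈ S₃, p₄.size ≤ a ∧ a < p₅.size := fun a ha =>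
    ⟨h₅.size_le (mem_union_left _ ha), h₅.lt_size (mem_union_left _ ha)⟩
  have mB₃ : ∀ a ∈ B₃, p₄.size ≤ a ∧ a < p₅.size := fun a ha =>
    ⟨h₅.size_le (mem_union_right _ ha), h₅.lt_size (mem_union_right _ ha)⟩
  have hBB₁ : ∀ a ∈ B₁, ∀ b ∈ B₁, a ≠ b → p₇.graph.Adj a b := fun a ha b hb hab => by
    rw [hp₇, addClique_adj_of_lt (mB₁ a ha).2 (mB₁ b hb).2]
    exact newClique_adj ha hb hab
  have hBB₂ : ∀ a ∈ B₂, ∀ b ∈ B₂, a ≠ b → p₇.graph.Adj a b :=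
    fun a ha b hb => newClique_adj ha hb
  have hSB₁ : ∀ a ∈ S₁, ∀ b ∈ B₁, p₇.graph.Adj a b := fun a ha b hb =>
    (g₁ a (by have := mS₁ a ha; omega) b hb).2 (by simp [ha])
  have hSB₂ : ∀ a ∈ S₂, ∀ b ∈ B₂, p₇.graph.Adj a b := fun a ha b hb =>
    (g₂ a (by have := mS₂ a ha; omega) b hb).2 (by simp [ha])
  have cell₀ : HasRepEnds p₇.graph (S₀ ∪ B₀) B₀ B₀ (2 * k) L (W + 2) :=
    (hrep₀.congr mS₀ a₂₇).cell hd₀ hB₀.le hW hL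
      (fun a ha b hb => (a₂₇ a (mS₀ a ha) b (mB₀ b hb)).2 (hSB₀ a ha b hb))
      fun a ha b hb hab => (a₂₇ a (mB₀ a ha) b (mB₀ b hb)).2 (hBB₀ a ha b hb hab)
  have cell₁ : HasRepEnds p₇.graph (S₁ ∪ B₁) B₁ B₁ (2 * k) L (W + 2) :=
    (hrep₁.congr (fun a ha => (mS₁ a ha).2) a₃₇).cell
      (disjoint_left.2 fun a ha hb => by
        have := mS₁ a ha
        have := mB₁ a hb
        omega) card_newClique.le hW hL hSB₁ hBB₁
  have cell₂ : HasRepEnds p₇.graph (S₂ ∪ B₂) B₂ B₂ (2 * k) L (W + 2) :=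
    (hrep₂.congr (fun a ha => (mS₂ a ha).2) a₄₇).cell
      (disjoint_left.2 fun a ha hb => by
        have := mS₂ a ha
        have := mB₂ a hb
        omega) card_newClique.le hW hL hSB₂ hBB₂
  have cell₃ : HasRepEnds p₇.graph (S₃ ∪ B₃) B₃ B₃ (2 * k) L (W + 2) :=
    (hrep₃.congr (fun a ha => (mS₃ a ha).2) a₅₇).cell hd₃ hB₃.le hW hL
      (fun a ha b hb => (a₅₇ a (mS₃ a ha).2 b (mB₃ b hb).2).2 (hSB₃ a ha b hb))
      fun a ha b hb hab => (a₅₇ a (mB₃ a ha).2 b (mB₃ b hb).2).2 (hBB₃ a ha b hb hab)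
  have hW₂ : 0 < W + 2 := by positivity
  have cB₁ : B₁.card = k := card_newClique
  have cB₂ : B₂.card = k := card_newClique
  have glue₁ := cell₀.glue cell₁ hW₂ hW₂ subset_union_right subset_union_right
    (disjoint_left.2 (by grind)) (by omega) (by
      intro a ha b hb
      have := f₂ a
      have := g₁ a
      have := p₇.graph.adj_comm a b
      grind)
  have glue₂ := glue₁.glue cell₂ (by positivity) hW₂ (by grind) subset_union_right
    (disjoint_left.2 (by grind)) (by omega) (by
      intro a ha b hb
      have := f₃ a
      have := g₂ a
      have := p₇.graph.adj_comm a b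
      grind)
  have glue₃ := glue₂.glue cell₃ (by positivity) hW₂ (by grind) subset_union_right
    (disjoint_left.2 (by grind)) (by omega) (by
      intro a ha b hb
      have := f₄ a
      have := g₁ b
      have := g₂ b
      have := p₇.graph.adj_comm a b
      grind)
  refine ⟨_, ?_, p₇, _, hfresh, ?_, rfl⟩
  · have hC₁' : S₁.image (vertexColor A p₇.graph) = C :=
      (image_vertexColor_congr A (fun a ha => (mS₁ a ha).2) a₃₇).trans hC₁
    have hC₂' : S₂.image (vertexColor A p₇.graph) = C :=
      (image_vertexColor_congr A (fun a ha => (mS₂ a ha).2) a₄₇).trans hC₂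
    have hC₀' : S₀.image (vertexColor A p₇.graph) = C :=
      (image_vertexColor_congr A mS₀ a₂₇).trans hC₀
    have hD₀' : B₀.image (vertexColor A p₇.graph) = D :=
      (image_vertexColor_congr A mB₀ a₂₇).trans hD₀
    have hD₃' : B₃.image (vertexColor A p₇.graph) = D :=
      (image_vertexColor_congr A (fun a ha => (mB₃ a ha).2) a₅₇).trans hD₃
    have dCD := hC₀' ▸ hD₀' ▸ hA.disjoint_image (G := p₇.graph) (S := S₀) (T := B₀)
      fun a ha b hb => (a₂₇ a (mS₀ a ha) b (mB₀ b hb)).2 (hSB₀ a ha b hb)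
    have dC₁ := hC₁' ▸ hA.disjoint_image hSB₁
    have dC₂ := hC₂' ▸ hA.disjoint_image hSB₂
    have dD₁ := hD₀' ▸ hA.disjoint_image (G := p₇.graph) (S := B₀) (T := B₁) fun a ha b hb =>
      (g₁ a (by have := mB₀ a ha; omega) b hb).2 (by simp [ha])
    have dD₂ := hD₃' ▸ hA.disjoint_image (G := p₇.graph) (S := B₃) (T := B₂) fun a ha b hb =>
      (g₂ a (by have := mB₃ a ha; omega) b hb).2 (by simp [ha])
    have d₁₂ := hA.disjoint_image (G := p₇.graph) (S := B₁) (T := B₂) fun a ha b hb =>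
      (g₂ a (mB₁ a ha).2 b hb).2 (by simp [ha])
    have cD : D.card = k := by
      rw [← hD₀, hA.card_image_clique hBB₀, hB₀]
    have c₁ := hA.card_image_clique hBB₁
    have c₂ := hA.card_image_clique hBB₂
    simp only [image_union, hC₀', hC₁', hC₂', hD₀', hD₃']
    set D₁ := B₁.image (vertexColor A p₇.graph)
    set D₂ := B₂.image (vertexColor A p₇.graph)
    calc c + 3 * k ≤ (((C ∪ D) ∪ D₁) ∪ D₂).card := by
          rw [card_union_of_disjoint (by simp only [disjoint_union_left]; tauto),
            card_union_of_disjoint (by simp only [disjoint_union_left]; tauto),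
            card_union_of_disjoint dCD]
          omega
      _ ≤ _ := card_le_card (by grind)
  · convert glue₃.hasRep using 1
    · grind
    · ring

/-- One round of the strategy: four parts with equal color sets are joined by a path of
four cliques, of which the first and the last have equal color sets. -/
lemma canForce_step {p₀ : Position} {K : Finset ℕ} (hA : IsProper A)
    (hK : ∀ q, p₀.Ext q → q.Good ω L → ∀ i < q.size, vertexColor A q.graph i ∈ K)
    (hW : 0 ≤ W) (hL : W + 2 ≤ L) (hk : 2 * k ≤ ω)
    (h : ∀ p, p₀.Ext p → p.Good ω L → ∃ C : Finset ℕ, c ≤ C.card ∧ CanForce A ω L k W p C)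
    (hp₀ : p₀.Ext p) (hp : p.Good ω L) :
    ∃ C : Finset ℕ, c + 3 * k ≤ C.card ∧ CanForce A ω L (2 * k) (4 * (W + 2)) p C := by
  classical
  have hsub : ∀ (q : Position) (U : Finset ℕ), p₀.Ext q → q.Good ω L → (∀ a ∈ U, a < q.size) →
      U.image (vertexColor A q.graph) ∈ K.powerset := by
    intro q U hq hq' hU
    rw [mem_powerset]
    intro x hx
    obtain ⟨i, hi, rfl⟩ := mem_image.1 hx
    exact hK q hq hq' i (hU i hi)
  have hgood : ∀ {p q : Position} {U C : Finset ℕ}, Fresh ω L p q U → HasRep q.graph U k L W →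
      U.image (vertexColor A q.graph) = C → q.Good ω L :=
    fun hU hrep _ => hU.good hrep (by omega)
  have hgoodCell : ∀ {p q : Position} {U B : Finset ℕ}, Fresh ω L p q (U ∪ B) →
      HasRep q.graph U k L W → Disjoint U B → B.card = k →
      (∀ a ∈ U, ∀ b ∈ B, q.graph.Adj a b) →
      (∀ a ∈ B, ∀ b ∈ B, a ≠ b → q.graph.Adj a b) → q.Good ω L :=
    fun hU hrep hd hB hUB hBB =>
      hU.good (hrep.cell hd hB.le hW hL hUB hBB).hasRep hk
  obtain ⟨C, hC, p', hpp', hp', hCp'⟩ := exists_persistent_outcome Ext.refl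
    (fun _ _ _ => Ext.trans)
    (fun _ _ C => CanForce.of_ext (A := A) (ω := ω) (L := L) (k := k) (W := W) (C := C))
    {C ∈ K.powerset | c ≤ C.card} p hp (fun q hpq hq => by
      obtain ⟨C, hC, hqC⟩ := h q (hp₀.trans hpq) hq
      refine ⟨C, mem_filter.2 ⟨?_, hC⟩, hqC⟩
      obtain ⟨s, U, hU, hrep, rfl⟩ := hqC
      exact hsub s U (hp₀.trans (hpq.trans hU.1)) (hgood hU hrep rfl) fun a ha => hU.lt_size ha)
  have hcC : c ≤ C.card := (mem_filter.1 hC).2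
  obtain ⟨D, -, p₁, hp'p₁, hp₁, hDp₁⟩ := exists_persistent_outcome Ext.refl
    (fun _ _ _ => Ext.trans)
    (fun _ _ D => CanForceCell.of_ext (A := A) (ω := ω) (L := L) (k := k) (W := W) (D := D))
    K.powerset p' hp' (fun q hpq hq => by
      obtain ⟨D, hD⟩ := (hCp' q hpq hq).cell
      refine ⟨D, ?_, hD⟩
      obtain ⟨s, U, B, hU, hrep, -, rfl, hd, hB, hUB, hBB⟩ := hD
      exact hsub s B (hp₀.trans (hpp'.trans (hpq.trans hU.1)))
        (hgoodCell hU hrep hd hB hUB hBB) fun a ha => hU.lt_size (mem_union_right _ ha))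
  obtain ⟨p₂, S₀, B₀, h₂, hrep₀, hC₀, hD₀, hd₀, hB₀, hSB₀, hBB₀⟩ := hDp₁ p₁ (Ext.refl _) hp₁
  have hp₂ := hgoodCell h₂ hrep₀ hd₀ hB₀ hSB₀ hBB₀
  obtain ⟨p₃, S₁, h₃, hrep₁, hC₁⟩ := hCp' p₂ (hp'p₁.trans h₂.1) hp₂
  have hp₃ := hgood h₃ hrep₁ hC₁
  obtain ⟨p₄, S₂, h₄, hrep₂, hC₂⟩ := hCp' p₃ (hp'p₁.trans (h₂.1.trans h₃.1)) hp₃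
  have hp₄ := hgood h₄ hrep₂ hC₂
  obtain ⟨p₅, S₃, B₃, h₅, hrep₃, -, hD₃, hd₃, hB₃, hSB₃, hBB₃⟩ :=
    hDp₁ p₄ (h₂.1.trans (h₃.1.trans h₄.1)) hp₄
  obtain ⟨C', hC', hforce⟩ := canForce_join hA hW hL hcC h₂ hrep₀ hC₀ hD₀ hd₀ hB₀ hSB₀ hBB₀
    h₃ hrep₁ hC₁ h₄ hrep₂ hC₂ h₅ hrep₃ hD₃ hd₃ hB₃ hSB₃ hBB₃
  exact ⟨C', hC', hforce.of_ext (hpp'.trans hp'p₁)⟩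

lemma canForce_iterate {p₀ : Position} {K : Finset ℕ} (hA : IsProper A)
    (hK : ∀ q, p₀.Ext q → q.Good ω L → ∀ i < q.size, vertexColor A q.graph i ∈ K)
    (t : ℕ) (hk : 2 ^ t * k ≤ ω) (hL : 4 ^ t ≤ L) :
    ∀ p, p₀.Ext p → p.Good ω L → ∃ C : Finset ℕ, 3 * (2 ^ t * k) - 2 * k ≤ C.card ∧
      CanForce A ω L (2 ^ t * k) (4 ^ (t + 1) - 3) p C := by
  induction t with
  | zero =>
    intro p _ hp
    obtain ⟨C, hC, h⟩ := canForce_clique (k := k) hA hp (by simpa using hL)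
    refine ⟨C, by omega, ?_⟩
    norm_num
    exact h
  | succ t ih =>
    intro p hp₀ hp
    have h4 : (1 : ℝ) ≤ 4 ^ t := one_le_pow₀ (by norm_num)
    rw [pow_succ] at hL
    have h2 : 2 ^ (t + 1) * k = 2 * (2 ^ t * k) := by ring
    have hle : k ≤ 2 ^ t * k := Nat.le_mul_of_pos_left k (by positivity)
    obtain ⟨C, hC, q, U, hU, hrep, hUC⟩ := canForce_step hA hK
      (by rw [pow_succ]; linarith) (by rw [pow_succ]; linarith) (by omega)
      (ih (by omega) (by linarith)) hp₀ hp
    refine ⟨C, by omega, q, U, hU, ?_, hUC⟩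
    rw [h2]
    exact hrep.mono Subset.rfl le_rfl (by rw [pow_succ 4 (t + 1)]; linarith)

/-- The adversary reaches a position with many colors. -/
lemma exists_good_position (hA : IsProper A) (t : ℕ) (hk : 2 ^ t * k ≤ ω) (hL : 4 ^ t ≤ L) :
    ∃ p : Position, p.Good ω L ∧
      3 * (2 ^ t * k) - 2 * k ≤ ((range p.size).image (vertexColor A p.graph)).card := by
  by_contra! hlt
  let colors (p : Position) : Finset ℕ := (range p.size).image (vertexColor A p.graph)
  obtain ⟨p₀, hp₀, hmax⟩ : ∃ p₀ : Position, p₀.Good ω L ∧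
      ∀ q : Position, q.Good ω L → (colors q).card ≤ (colors p₀).card := by
    have hne : {p : Position | p.Good ω L}.Nonempty :=
      ⟨⟨0, ⊥⟩, 0, fun _ => 0, fun _ => 0, by simp, by simp, by simp⟩
    have hfin : ((fun p => (colors p).card) '' {p : Position | p.Good ω L}).Finite :=
      (Set.finite_lt_nat _).subset (by rintro _ ⟨p, hp, rfl⟩; exact hlt p hp)
    obtain ⟨_, ⟨p₀, hp₀, rfl⟩, h⟩ := Set.exists_max_image _ id hfin (hne.image _)
    exact ⟨p₀, hp₀, fun q hq => h _ ⟨q, hq, rfl⟩⟩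
  have hK : ∀ q, p₀.Ext q → q.Good ω L → ∀ i < q.size, vertexColor A q.graph i ∈ colors p₀ := by
    intro q hq hq' i hi
    have hsub : colors p₀ ⊆ colors q := by
      simp only [colors]
      rw [← image_vertexColor_congr A (fun i hi => mem_range.1 hi) hq.2.1]
      exact image_subset_image (range_subset_range.2 hq.1)
    rw [eq_of_subset_of_card_le hsub (hmax q hq')]
    exact mem_image_of_mem _ (mem_range.2 hi)
  obtain ⟨C, hC, q, U, hU, hrep, rfl⟩ :=
    canForce_iterate hA hK t hk hL p₀ (Ext.refl p₀) hp₀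
  refine absurd (hlt q (hU.good hrep hk)) (not_lt.2 (hC.trans (card_le_card ?_)))
  exact image_subset_image fun a ha => mem_range.2 (hU.lt_size ha)

end Strategy

/-- A good position is an interval graph, on which `A` uses the colors of the position. -/
lemma Position.Good.exists_intervals (A : OnlineAlg) {p : Position} {ω : ℕ} {L : ℝ}
    (hp : p.Good ω L) : ∃ x : Fin p.size → ℝ × ℝ,
      (∀ i, 1 ≤ (x i).2 - (x i).1 ∧ (x i).2 - (x i).1 ≤ L) ∧
      (∀ t : ℝ, {i | t ∈ Set.Icc (x i).1 (x i).2}.ncard ≤ ω) ∧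
      (Set.range (onlineColoring A (intervalGraph x))).ncard =
        ((range p.size).image (vertexColor A p.graph)).card := by
  obtain ⟨W, l, r, h₁, h₂, h₃⟩ := hp
  refine ⟨fun i => (l i, r i), fun i => (h₁ i (mem_range.2 i.2)).2.2, fun t => ?_, ?_⟩
  · refine le_trans ?_ (h₃ t)
    rw [← Set.ncard_coe_finset]
    refine Set.ncard_le_ncard_of_injOn Fin.val (fun i hi => ?_) Fin.val_injective.injOn
    simpa using hi
  · have hcolor : ∀ i : Fin p.size, onlineColoring A (intervalGraph fun i => (l i, r i)) i =
        vertexColor A p.graph i := by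
      intro i
      unfold onlineColoring vertexColor
      congr 1
      ext a b
      have ha : a.1 ∈ range p.size := mem_range.2 (by omega)
      have hb : b.1 ∈ range p.size := mem_range.2 (by omega)
      have hla := h₁ a ha
      have hlb := h₁ b hb
      by_cases hab : a.1 = b.1
      · obtain rfl := Fin.ext hab
        simp
      · have hne : Fin.castLE i.isLt a ≠ Fin.castLE i.isLt b := fun h =>
          hab (by simpa [Fin.ext_iff] using h)
        simp only [SimpleGraph.comap_adj, intervalGraph, SimpleGraph.fromRel_adj, hne, ne_eq,
          not_false_eq_true, true_and, Set.Icc_inter_Icc, Set.nonempty_Icc, h₂ a ha b hb hab,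
          sup_le_iff, le_inf_iff, Fin.val_castLE]
        constructor
        · rintro (h | h)
          · exact ⟨h.2.1, h.1.2⟩
          · exact ⟨h.1.2, h.2.1⟩
        · rintro ⟨h, h'⟩
          exact Or.inl ⟨⟨by linarith, h'⟩, h, by linarith⟩
    rw [← Set.ncard_coe_finset]
    congr 1
    ext c
    simp only [Set.mem_range, hcolor, coe_image, coe_range, Set.mem_image, Set.mem_Iio]
    exact ⟨fun ⟨i, hi⟩ => ⟨i, i.2, hi⟩, fun ⟨i, hi, hi'⟩ => ⟨⟨i, hi⟩, hi'⟩⟩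

lemma exists_scale {ε σ : ℝ} (hε : 0 < ε) (hε3 : ε < 3) (hσ : 27 / ε ^ 2 < σ) :
    ∃ t : ℕ, 2 ≤ ε * 2 ^ t ∧ (4 : ℝ) ^ t < σ := by
  classical
  have hex : ∃ t : ℕ, 2 ≤ ε * 2 ^ t := by
    obtain ⟨t, ht⟩ := pow_unbounded_of_one_lt (2 / ε) (one_lt_two (α := ℝ))
    rw [div_lt_iff₀ hε] at ht
    exact ⟨t, by linarith⟩
  refine ⟨Nat.find hex, Nat.find_spec hex, lt_of_le_of_lt ?_ hσ⟩
  rw [le_div_iff₀ (by positivity)]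
  rcases h : Nat.find hex with _ | t
  · rw [pow_zero]
    nlinarith
  · have hlt : ε * 2 ^ t < 2 := not_le.1 (Nat.find_min hex (by omega))
    have h4 : (4 : ℝ) ^ (t + 1) * ε ^ 2 = 4 * (ε * 2 ^ t) ^ 2 := by
      rw [pow_succ, show (4 : ℝ) = 2 ^ 2 by norm_num, ← pow_mul, mul_comm 2 t, pow_mul]
      ring
    have hpos : 0 < ε * 2 ^ t := by positivity
    rw [h4]
    nlinarith

theorem stmt1 (ε : ℝ) (hε : 0 < ε) (σ : ℝ) (hσ : 27 / ε ^ 2 < σ) :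
    ∀ δ : ℝ, 0 < δ → ∃ ω₀ : ℕ, ∀ ω : ℕ, ω₀ ≤ ω →
      ∀ A : OnlineAlg, IsProper A →
        ∃ (n : ℕ) (x : Fin n → ℝ × ℝ),
          (∀ i, 1 ≤ (x i).2 - (x i).1 ∧ (x i).2 - (x i).1 < σ) ∧
          (∀ t : ℝ, {i : Fin n | t ∈ Set.Icc (x i).1 (x i).2}.ncard ≤ ω) ∧
          (3 - ε - δ) * (ω : ℝ) ≤ ((Set.range (onlineColoring A (intervalGraph x))).ncard : ℝ) := by
  intro δ hδ
  rcases le_or_gt 3 ε with hε3 | hε3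
  · refine ⟨0, fun ω _ A _ => ⟨0, Fin.elim0, fun i => i.elim0,
      fun t => by simp [Set.eq_empty_of_isEmpty], ?_⟩⟩
    exact (mul_nonpos_of_nonpos_of_nonneg (by linarith) ω.cast_nonneg).trans (Nat.cast_nonneg _)
  obtain ⟨t, ht, htσ⟩ := exists_scale hε hε3 hσ
  obtain ⟨ω₀, hω₀⟩ := exists_nat_ge (3 * 2 ^ t / δ)
  refine ⟨ω₀, fun ω hω A hA => ?_⟩
  obtain ⟨p, hp, hcard⟩ := exists_good_position (k := ω / 2 ^ t) hA t (Nat.mul_div_le _ _) le_rfl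
  obtain ⟨x, hlen, hclique, hcolors⟩ := hp.exists_intervals A
  refine ⟨p.size, x, fun i => ⟨(hlen i).1, (hlen i).2.trans_lt htσ⟩, hclique, ?_⟩
  rw [hcolors]
  set m := ((Finset.range p.size).image (vertexColor A p.graph)).card
  set k := ω / 2 ^ t with hk
  have hm : (3 * (2 ^ t * k) : ℝ) ≤ m + 2 * k := by
    exact_mod_cast (by omega : 3 * (2 ^ t * k) ≤ m + 2 * k)
  have hkω : (2 ^ t * k : ℝ) ≤ ω := by exact_mod_cast Nat.mul_div_le ω (2 ^ t)
  have hωk : (ω : ℝ) ≤ 2 ^ t * k + 2 ^ t := by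
    exact_mod_cast (Nat.lt_mul_div_succ ω (by positivity : 0 < 2 ^ t)).le
  have h2k : (2 * k : ℝ) ≤ ε * ω :=
    calc (2 * k : ℝ) ≤ ε * 2 ^ t * k := by gcongr
      _ = ε * (2 ^ t * k) := by ring
      _ ≤ ε * ω := by gcongr
  have hδω : 3 * 2 ^ t ≤ δ * (ω : ℝ) := by
    rw [div_le_iff₀ hδ] at hω₀
    have : (ω₀ : ℝ) ≤ ω := by exact_mod_cast hω
    nlinarith
  linarith
end

section
/- For every real ρ < 5/2 and every real b, there exists a finite sequence of closed intervals in ℝ whose lengths take at most two distinct values (the values 1 and 8 suffice) such that the First-Fit coloring of the sequence uses more than ρ·ω + b colors, where ω is the clique number of the sequence. -/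
/-- Auxiliary definition of the First-Fit coloring of a sequence of closed
intervals: `firstFitAux x k` is the coloring of the first `k` intervals
(and `0` on the rest). Interval `i` gets the least positive integer not used
on an earlier interval intersecting it. -/
noncomputable def firstFitAux {n : ℕ} (x : Fin n → ℝ × ℝ) : ℕ → Fin n → ℕ
  | 0 => fun _ => 0
  | k + 1 => fun i =>
      if i.1 = k then
        sInf {c : ℕ | 1 ≤ c ∧ ∀ j : Fin n, j < i →
          (Set.Icc (x j).1 (x j).2 ∩ Set.Icc (x i).1 (x i).2).Nonempty →
          firstFitAux x k j ≠ c}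
      else firstFitAux x k i

/-- The First-Fit coloring of a finite sequence of closed intervals. -/
noncomputable def firstFit {n : ℕ} (x : Fin n → ℝ × ℝ) (i : Fin n) : ℕ :=
  firstFitAux x (i.1 + 1) i

/-- Two closed intervals, given by their endpoints, intersect. -/
def Meets (p q : ℝ × ℝ) : Prop := (Set.Icc p.1 p.2 ∩ Set.Icc q.1 q.2).Nonempty

theorem meets_iff {p q : ℝ × ℝ} (hp : p.1 ≤ p.2) (hq : q.1 ≤ q.2) :
    Meets p q ↔ p.1 ≤ q.2 ∧ q.1 ≤ p.2 := by
  unfold Meets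
  rw [Set.Icc_inter_Icc, Set.nonempty_Icc]
  simp [hp, hq, and_comm]

theorem firstFitAux_eq_firstFit {n : ℕ} (x : Fin n → ℝ × ℝ) (k : ℕ) (j : Fin n) (h : j.1 < k) :
    firstFitAux x k j = firstFit x j := by
  induction k with
  | zero => omega
  | succ k ih =>
    by_cases hj : j.1 = k
    · subst hj; rfl
    · rw [firstFitAux]
      exact (if_neg hj).trans (ih (by omega))

theorem firstFit_eq_sInf {n : ℕ} (x : Fin n → ℝ × ℝ) (i : Fin n) :
    firstFit x i =
      sInf {c : ℕ | 1 ≤ c ∧ ∀ j : Fin n, j < i → Meets (x j) (x i) → firstFit x j ≠ c} := by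
  rw [firstFit, firstFitAux]
  refine (if_pos rfl).trans ?_
  congr 1
  ext c
  refine and_congr_right fun _ => forall_congr' fun j => forall_congr' fun hj => ?_
  rw [firstFitAux_eq_firstFit x i.1 j hj]
  rfl

/-- A proper coloring that is monotone in the order of the sequence and in which every vertex sees
all smaller colors is the First-Fit coloring. -/
theorem firstFit_eq_of_grundy {n : ℕ} (x : Fin n → ℝ × ℝ) (col : Fin n → ℕ)
    (hpos : ∀ i, 1 ≤ col i) (hmono : Monotone col)
    (hproper : ∀ i j, i ≠ j → col i = col j → ¬ Meets (x i) (x j))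
    (hsees : ∀ i c, 1 ≤ c → c < col i → ∃ j, col j = c ∧ Meets (x j) (x i)) :
    firstFit x = col := by
  funext i
  induction i using WellFoundedLT.induction with
  | ind i ih =>
    rw [firstFit_eq_sInf]
    refine IsLeast.csInf_eq ⟨⟨hpos i, fun j hj hm => ?_⟩, fun c hc => ?_⟩
    · rw [ih j hj]
      exact fun h => hproper j i hj.ne h hm
    · by_contra! hlt
      obtain ⟨j, hj, hm⟩ := hsees i c hc.1 hlt
      have hji : j < i := hmono.reflect_lt (hj ▸ hlt)
      exact hc.2 j hji hm ((ih j hji).trans hj)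

/-- A finite family of intervals with a Grundy coloring can be presented as a sequence
whose First-Fit coloring is the given one. -/
theorem exists_sequence_of_grundy {ι : Type*} [Fintype ι] (I : ι → ℝ × ℝ) (col : ι → ℕ)
    (hpos : ∀ i, 1 ≤ col i)
    (hproper : ∀ i j, i ≠ j → col i = col j → ¬ Meets (I i) (I j))
    (hsees : ∀ i c, 1 ≤ c → c < col i → ∃ j, col j = c ∧ Meets (I j) (I i)) :
    ∃ (n : ℕ) (e : Fin n ≃ ι), firstFit (I ∘ e) = col ∘ e := by
  let e₀ : Fin (Fintype.card ι) ≃ ι := (Fintype.equivFin ι).symm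
  let e : Fin (Fintype.card ι) ≃ ι := (Tuple.sort (col ∘ e₀)).trans e₀
  refine ⟨_, e, firstFit_eq_of_grundy _ _ (fun i => hpos _) (Tuple.monotone_sort (col ∘ e₀))
    (fun i j hij h => hproper _ _ (e.injective.ne hij) h) fun i c h1 hc => ?_⟩
  obtain ⟨j, hj, hm⟩ := hsees (e i) c h1 hc
  exact ⟨e.symm j, by simpa using hj, by simpa using hm⟩

/-- Lengths of the seven intervals in a row of the construction. -/
def slotLength : Fin 7 → ℝ := ![1, 1, 1, 1, 1, 8, 1]

/-- Left endpoints of the seven intervals in a row with offset `u`: five consecutive unit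
intervals, a long interval, and a unit interval. -/
def slotStart (d u : ℝ) : Fin 7 → ℝ := ![-2 - u, -1 - u, -u, 1 - u, 2 - u, 3, 11 + d]

/-- The interval in slot `r` of a row with offset `u`; the rows with `s = true` are the mirror
images, under `t ↦ 10 - t`, of those with `s = false`. -/
def slotInterval (d u : ℝ) (s : Bool) (r : Fin 7) : ℝ × ℝ :=
  bif s then (10 - (slotStart d u r + slotLength r), 10 - slotStart d u r)
  else (slotStart d u r, slotStart d u r + slotLength r)

/-- The block of consecutive colors to which a slot belongs. -/
def slotBlock (s : Bool) : Fin 7 → ℕ := ![0, 2, 0, 1, 0, bif s then 3 else 4, 1]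

theorem slotLength_pos (r : Fin 7) : 0 < slotLength r := by
  fin_cases r <;> simp [slotLength]

theorem slotInterval_le (d u : ℝ) (s : Bool) (r : Fin 7) :
    (slotInterval d u s r).1 ≤ (slotInterval d u s r).2 := by
  have := slotLength_pos r
  cases s <;> simp [slotInterval] <;> linarith

theorem slotInterval_length (d u : ℝ) (s : Bool) (r : Fin 7) :
    (slotInterval d u s r).2 - (slotInterval d u s r).1 = 1 ∨
      (slotInterval d u s r).2 - (slotInterval d u s r).1 = 8 := by
  have : slotLength r = 1 ∨ slotLength r = 8 := by fin_cases r <;> simp [slotLength]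
  cases s <;> simpa [slotInterval] using this

theorem meets_slotInterval_self {d u v : ℝ} (huv : |u - v| ≤ 1) (s : Bool) (r : Fin 7) :
    Meets (slotInterval d v s r) (slotInterval d u s r) := by
  rw [meets_iff (slotInterval_le ..) (slotInterval_le ..)]
  obtain ⟨h1, h2⟩ := abs_le.1 huv
  cases s <;> fin_cases r <;> simp [slotInterval, slotStart, slotLength] <;>
    first | (constructor <;> linarith) | linarith

/-- Intervals of one color are pairwise disjoint. -/
theorem not_meets_slotInterval {d u : ℝ} (hd : 0 < d) (hu : 0 < u) (hu1 : u ≤ 1)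
    {s s' : Bool} {r r' : Fin 7} (hne : (s, r) ≠ (s', r')) (h : slotBlock s r = slotBlock s' r') :
    ¬ Meets (slotInterval d u s r) (slotInterval d u s' r') := by
  rw [meets_iff (slotInterval_le ..) (slotInterval_le ..)]
  rintro ⟨h1, h2⟩
  cases s <;> cases s' <;> fin_cases r <;> fin_cases r' <;>
    simp [slotBlock] at h hne <;>
    simp [slotInterval, slotStart, slotLength] at h1 h2 <;> linarith

/-- Every interval meets intervals of all colors in smaller blocks. -/
theorem exists_meets_of_lt_slotBlock {d u v : ℝ} (hd : 0 < d) (hdu : d ≤ u) (hu : u ≤ 1)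
    (hdv : d ≤ v) (hv : v ≤ 1) (s : Bool) (r : Fin 7) (g : ℕ) (hg : g < slotBlock s r) :
    ∃ s' r', slotBlock s' r' = g ∧ Meets (slotInterval d v s' r') (slotInterval d u s r) := by
  have same : ∀ r' r : Fin 7, slotStart d v r' ≤ slotStart d u r + slotLength r →
      slotStart d u r ≤ slotStart d v r' + slotLength r' →
      Meets (slotInterval d v s r') (slotInterval d u s r) := by
    intro r' r h h'
    rw [meets_iff (slotInterval_le ..) (slotInterval_le ..)]
    cases s <;> simp [slotInterval] <;> constructor <;> linarith
  have opposite : ∀ r' r : Fin 7,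
      10 ≤ slotStart d v r' + slotLength r' + (slotStart d u r + slotLength r) →
      slotStart d v r' + slotStart d u r ≤ 10 →
      Meets (slotInterval d v (!s) r') (slotInterval d u s r) := by
    intro r' r h h'
    rw [meets_iff (slotInterval_le ..) (slotInterval_le ..)]
    cases s <;> simp [slotInterval] <;> constructor <;> linarith
  have hsame : ∀ r' r'' r : Fin 7, (r' = 0 ∧ r = 1 ∧ r'' = 2 ∨ r' = 2 ∧ r = 3 ∧ r'' = 4) →
      ∃ s' q, slotBlock s' q = 0 ∧ Meets (slotInterval d v s' q) (slotInterval d u s r) := by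
    intro r' r'' r h
    rcases le_total v u with hvu | hvu
    · refine ⟨s, r', ?_, same _ _ ?_ ?_⟩ <;> rcases h with ⟨rfl, rfl, rfl⟩ | ⟨rfl, rfl, rfl⟩ <;>
        simp [slotBlock, slotStart, slotLength] <;> linarith
    · refine ⟨s, r'', ?_, same _ _ ?_ ?_⟩ <;> rcases h with ⟨rfl, rfl, rfl⟩ | ⟨rfl, rfl, rfl⟩ <;>
        simp [slotBlock, slotStart, slotLength] <;> linarith
  have hopposite : ∀ r' r : Fin 7,
      (r' = 6 ∧ r = 1 ∨ r' = 2 ∧ r = 5 ∨ r' = 3 ∧ r = 5 ∨ r' = 1 ∧ r = 5 ∨ r' = 5 ∧ r = 5 ∨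
        r' = 0 ∧ r = 6) → Meets (slotInterval d v (!s) r') (slotInterval d u s r) := by
    intro r' r h
    apply opposite <;> rcases h with ⟨rfl, rfl⟩ | ⟨rfl, rfl⟩ | ⟨rfl, rfl⟩ | ⟨rfl, rfl⟩ |
      ⟨rfl, rfl⟩ | ⟨rfl, rfl⟩ <;> simp [slotStart, slotLength] <;> linarith
  fin_cases r <;> simp [slotBlock] at hg
  · interval_cases g
    · exact hsame 0 2 1 (by simp)
    · exact ⟨!s, 6, rfl, hopposite 6 1 (by simp)⟩
  · subst hg
    exact hsame 2 4 3 (by simp)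
  · have hg4 : g < 4 := by cases s <;> simp at hg <;> omega
    interval_cases g
    · exact ⟨!s, 2, rfl, hopposite 2 5 (by simp)⟩
    · exact ⟨!s, 3, rfl, hopposite 3 5 (by simp)⟩
    · exact ⟨!s, 1, rfl, hopposite 1 5 (by simp)⟩
    · refine ⟨!s, 5, ?_, hopposite 5 5 (by simp)⟩
      cases s <;> simp [slotBlock] at hg ⊢
  · subst hg
    exact ⟨!s, 0, rfl, hopposite 0 6 (by simp)⟩

open Classical in
/-- A point lies in at most `m + 1` intervals of the `m` rows of one orientation. -/
theorem ncard_slotInterval_false_le {m : ℕ} {d : ℝ} (hd : 0 < d) {u : Fin m → ℝ}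
    (hu : ∀ a, 0 < u a) (hu1 : ∀ a, u a ≤ 1) (huinj : Function.Injective u) (t : ℝ) :
    {p : Fin 7 × Fin m | t ∈ Set.Icc (slotInterval d (u p.2) false p.1).1
      (slotInterval d (u p.2) false p.1).2}.ncard ≤ m + 1 := by
  let f : Fin 7 × Fin m → Option (Fin m) := fun p =>
    if p.1 < 5 ∧ t = slotStart d (u p.2) p.1 + slotLength p.1 then none else some p.2
  have hf : Set.InjOn f {p : Fin 7 × Fin m | t ∈ Set.Icc (slotInterval d (u p.2) false p.1).1
      (slotInterval d (u p.2) false p.1).2} := by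
    rintro ⟨r, a⟩ ⟨h1, h2⟩ ⟨r', a'⟩ ⟨h1', h2'⟩ h
    simp only [slotInterval, cond_false] at h1 h2 h1' h2'
    simp only [f] at h
    have hua := hu a
    have hua1 := hu1 a
    have hua' := hu a'
    have hua1' := hu1 a'
    split_ifs at h with ht ht'
    · have : r = r' := by
        obtain ⟨hr, ht⟩ := ht
        obtain ⟨hr', ht'⟩ := ht'
        rw [ht] at ht'
        fin_cases r <;> fin_cases r' <;> simp at hr hr' ⊢ <;>
          simp [slotStart, slotLength] at ht' <;> linarith
      subst this
      obtain ⟨hr, ht⟩ := ht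
      obtain ⟨-, ht'⟩ := ht'
      rw [ht] at ht'
      have : u a = u a' := by
        fin_cases r <;> simp at hr <;> simp [slotStart, slotLength] at ht' <;> linarith
      rw [huinj this]
    · obtain rfl : a = a' := by simpa using h
      rename_i ht'
      have : r = r' := by
        have hlt : r < 5 → t < slotStart d (u a) r + slotLength r :=
          fun hr => lt_of_le_of_ne h2 fun h => ht ⟨hr, h⟩
        have hlt' : r' < 5 → t < slotStart d (u a) r' + slotLength r' :=
          fun hr => lt_of_le_of_ne h2' fun h => ht' ⟨hr, h⟩
        fin_cases r <;> fin_cases r' <;> simp at hlt hlt' ⊢ <;>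
          simp [slotStart, slotLength] at h1 h2 h1' h2' hlt hlt' <;> linarith
      rw [this]
  calc _ ≤ (Set.univ : Set (Option (Fin m))).ncard :=
        Set.ncard_le_ncard_of_injOn f (fun _ _ => Set.mem_univ _) hf
    _ = m + 1 := by simp [Set.ncard_univ]

/-- A point lies in at most `2 * m + 2` intervals of the construction. -/
theorem ncard_slotInterval_le {m : ℕ} {d : ℝ} (hd : 0 < d) {u : Fin m → ℝ}
    (hu : ∀ a, 0 < u a) (hu1 : ∀ a, u a ≤ 1) (huinj : Function.Injective u) (t : ℝ) :
    {p : Bool × Fin 7 × Fin m | t ∈ Set.Icc (slotInterval d (u p.2.2) p.1 p.2.1).1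
      (slotInterval d (u p.2.2) p.1 p.2.1).2}.ncard ≤ 2 * m + 2 := by
  let S : ℝ → Set (Fin 7 × Fin m) := fun t =>
    {p | t ∈ Set.Icc (slotInterval d (u p.2) false p.1).1 (slotInterval d (u p.2) false p.1).2}
  have hS : ∀ t, (S t).ncard ≤ m + 1 := ncard_slotInterval_false_le hd hu hu1 huinj
  have hsub : {p : Bool × Fin 7 × Fin m | t ∈ Set.Icc (slotInterval d (u p.2.2) p.1 p.2.1).1
      (slotInterval d (u p.2.2) p.1 p.2.1).2} ⊆
      Prod.mk false '' S t ∪ Prod.mk true '' S (10 - t) := by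
    rintro ⟨s, p⟩ ⟨h1, h2⟩
    cases s
    · exact Or.inl ⟨p, ⟨h1, h2⟩, rfl⟩
    · refine Or.inr ⟨p, ⟨?_, ?_⟩, rfl⟩ <;> simp [slotInterval] at h1 h2 ⊢ <;> linarith
  have h1 := Set.ncard_le_ncard hsub (Set.toFinite _)
  have h2 := Set.ncard_union_le (Prod.mk false '' S t) (Prod.mk true '' S (10 - t))
  have h3 := Set.ncard_image_le (f := Prod.mk false) (Set.toFinite (S t))
  have h4 := Set.ncard_image_le (f := Prod.mk true) (Set.toFinite (S (10 - t)))
  have h5 := hS t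
  have h6 := hS (10 - t)
  omega

/-- For every `m` there are intervals of lengths `1` and `8` with clique number at most
`2 * m + 2` on which First-Fit uses at least `5 * m` colors. -/
theorem exists_firstFit_five_mul {m : ℕ} (hm : 0 < m) :
    ∃ (n : ℕ) (x : Fin n → ℝ × ℝ),
      (∀ i, (x i).2 - (x i).1 = 1 ∨ (x i).2 - (x i).1 = 8) ∧
      (∀ t : ℝ, {i : Fin n | t ∈ Set.Icc (x i).1 (x i).2}.ncard ≤ 2 * m + 2) ∧
      5 * m ≤ (Set.range (firstFit x)).ncard := by
  have hm' : (0 : ℝ) < m := by exact_mod_cast hm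
  let d : ℝ := 1 / m
  let u : Fin m → ℝ := fun a => (a.1 + 1) / m
  have hd : 0 < d := by positivity
  have hdu : ∀ a, d ≤ u a := fun a => by simp only [d, u]; gcongr; simp
  have hu : ∀ a, 0 < u a := fun a => hd.trans_le (hdu a)
  have hu1 : ∀ a, u a ≤ 1 := fun a => by
    rw [div_le_one hm']
    exact_mod_cast a.2
  have huinj : Function.Injective u := fun a a' h => by
    have h' : (a.1 : ℝ) + 1 = a'.1 + 1 := (div_left_inj' hm'.ne').1 h
    exact Fin.ext (by exact_mod_cast add_right_cancel h')
  let I : Bool × Fin 7 × Fin m → ℝ × ℝ := fun p => slotInterval d (u p.2.2) p.1 p.2.1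
  let col : Bool × Fin 7 × Fin m → ℕ := fun p => m * slotBlock p.1 p.2.1 + p.2.2.1 + 1
  have hdecomp : ∀ (g : ℕ) (a : Fin m), (m * g + a.1) / m = g ∧ (m * g + a.1) % m = a.1 :=
    fun g a => ⟨by rw [Nat.mul_add_div hm, Nat.div_eq_of_lt a.2, add_zero],
      by rw [Nat.mul_add_mod, Nat.mod_eq_of_lt a.2]⟩
  have hproper : ∀ p q, p ≠ q → col p = col q → ¬ Meets (I p) (I q) := by
    rintro ⟨s, r, a⟩ ⟨s', r', a'⟩ hne h
    have h' : m * slotBlock s r + a.1 = m * slotBlock s' r' + a'.1 := Nat.succ_injective h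
    have hb : slotBlock s r = slotBlock s' r' := by
      rw [← (hdecomp (slotBlock s r) a).1, h', (hdecomp _ _).1]
    obtain rfl : a = a' := Fin.ext (by rw [hb] at h'; omega)
    exact not_meets_slotInterval hd (hu a) (hu1 a) (fun h => hne (by simp_all)) hb
  have hsees : ∀ p c, 1 ≤ c → c < col p → ∃ q, col q = c ∧ Meets (I q) (I p) := by
    rintro ⟨s, r, a⟩ c hc hlt
    obtain ⟨c, rfl⟩ : ∃ k, c = k + 1 := ⟨c - 1, by omega⟩
    have hlt' : c < m * slotBlock s r + a.1 := Nat.succ_lt_succ_iff.1 hlt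
    let b : Fin m := ⟨c % m, Nat.mod_lt _ hm⟩
    have hc' : m * (c / m) + b.1 + 1 = c + 1 := by rw [Nat.div_add_mod]
    have hle : c / m ≤ slotBlock s r := by
      rw [← (hdecomp (slotBlock s r) a).1]
      exact Nat.div_le_div_right hlt'.le
    rcases hle.lt_or_eq with hg | hg
    · obtain ⟨s', r', hb, hmeets⟩ :=
        exists_meets_of_lt_slotBlock hd (hdu a) (hu1 a) (hdu b) (hu1 b) s r _ hg
      exact ⟨(s', r', b), by simpa only [col, hb] using hc', hmeets⟩
    · refine ⟨(s, r, b), by simpa only [col, ← hg] using hc', meets_slotInterval_self ?_ s r⟩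
      rw [abs_le]
      constructor <;> linarith [hu a, hu b, hu1 a, hu1 b]
  obtain ⟨n, e, he⟩ := exists_sequence_of_grundy I col (fun _ => Nat.succ_pos _) hproper hsees
  refine ⟨n, I ∘ e, fun i => slotInterval_length .., fun t => ?_, ?_⟩
  · refine le_trans ?_ (ncard_slotInterval_le hd hu hu1 huinj t)
    exact Set.ncard_le_ncard_of_injOn e (fun i hi => hi) e.injective.injOn
  · rw [he, Set.range_comp, e.surjective.range_eq, Set.image_univ]
    have hsub : (Finset.Icc 1 (5 * m) : Set ℕ) ⊆ Set.range col := by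
      intro c hc
      rw [Finset.coe_Icc, Set.mem_Icc] at hc
      have htop : col (false, 5, ⟨m - 1, by omega⟩) = 5 * m := by
        simp [col, slotBlock]
        omega
      rcases hc.2.lt_or_eq with h | h
      · obtain ⟨q, hq, -⟩ := hsees _ c hc.1 (htop ▸ h)
        exact ⟨q, hq⟩
      · exact ⟨_, htop.trans h.symm⟩
    simpa [Set.ncard_coe_finset] using Set.ncard_le_ncard hsub (Set.finite_range col)

theorem stmt9 (ρ : ℝ) (hρ : ρ < 5 / 2) (b : ℝ) :
    ∃ (n : ℕ) (x : Fin n → ℝ × ℝ) (ω : ℕ),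
      (∀ i, (x i).2 - (x i).1 = 1 ∨ (x i).2 - (x i).1 = 8) ∧
      (∀ t : ℝ, {i : Fin n | t ∈ Set.Icc (x i).1 (x i).2}.ncard ≤ ω) ∧
      (∃ t : ℝ, {i : Fin n | t ∈ Set.Icc (x i).1 (x i).2}.ncard = ω) ∧
      ρ * (ω : ℝ) + b < ((Set.range (firstFit x)).ncard : ℝ) := by
  set σ : ℝ := max ρ 0
  have hσ : 0 < 5 - 2 * σ := by
    have : σ < 5 / 2 := max_lt hρ (by norm_num)
    linarith
  obtain ⟨m, hm⟩ := exists_nat_gt (max 0 ((2 * σ + b) / (5 - 2 * σ)))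
  have hm0 : 0 < m := by exact_mod_cast (le_max_left _ _).trans_lt hm
  have hmb : 2 * σ + b < m * (5 - 2 * σ) := (div_lt_iff₀ hσ).1 ((le_max_right _ _).trans_lt hm)
  obtain ⟨n, x, hlen, hcount, hcol⟩ := exists_firstFit_five_mul hm0
  let counts : Set ℕ := Set.range fun t : ℝ => {i : Fin n | t ∈ Set.Icc (x i).1 (x i).2}.ncard
  have hbdd : BddAbove counts := ⟨2 * m + 2, by rintro _ ⟨t, rfl⟩; exact hcount t⟩
  obtain ⟨t, ht⟩ : sSup counts ∈ counts := Nat.sSup_mem (Set.range_nonempty _) hbdd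
  refine ⟨n, x, sSup counts, hlen, fun t => le_csSup hbdd ⟨t, rfl⟩, ⟨t, ht⟩, ?_⟩
  have hω : ((sSup counts : ℕ) : ℝ) ≤ 2 * m + 2 := by
    rw [← ht]
    exact_mod_cast hcount t
  have hcol' : (5 * m : ℝ) ≤ ((Set.range (firstFit x)).ncard : ℝ) := by exact_mod_cast hcol
  have h1 : ρ * ((sSup counts : ℕ) : ℝ) ≤ σ * ((sSup counts : ℕ) : ℝ) :=
    mul_le_mul_of_nonneg_right (le_max_left _ _) (Nat.cast_nonneg _)
  have h2 : σ * ((sSup counts : ℕ) : ℝ) ≤ σ * (2 * m + 2) :=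
    mul_le_mul_of_nonneg_left hω (le_max_right _ _)
  linarith
end

section
/- For every positive integer k there exists a real number L ≥ 1 (depending only on k) such that for every proper deterministic online coloring algorithm A with known representation, there exists a finite sequence of closed intervals in ℝ, each of length 1 or length L, whose clique number is at most 4k, on which A uses at least 7k colors. -/
/-- A deterministic online coloring algorithm with known representation:
it assigns to each finite sequence of closed intervals a color for the last
interval. -/
def KnownRepAlg : Type := ∀ i : ℕ, (Fin (i + 1) → ℝ × ℝ) → ℕ

/-- The coloring produced when a sequence of intervals is presented to the
algorithm `A` one by one. -/
def knownColoring (A : KnownRepAlg) {n : ℕ} (x : Fin n → ℝ × ℝ) (i : Fin n) : ℕ :=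
  A i.1 (x ∘ Fin.castLE i.isLt)

/-- The algorithm `A` is proper: on every presented sequence of closed
intervals, intersecting intervals receive distinct colors. -/
def IsProperKnown (A : KnownRepAlg) : Prop :=
  ∀ (n : ℕ) (x : Fin n → ℝ × ℝ), (∀ i, (x i).1 ≤ (x i).2) →
    ∀ i j : Fin n, i ≠ j →
      (Set.Icc (x i).1 (x i).2 ∩ Set.Icc (x j).1 (x j).2).Nonempty →
      knownColoring A x i ≠ knownColoring A x j

/-- A transcript of a play against `A`, latest move first: the presented intervals, each
paired with the color that `A` gave to it. -/
def IsTranscript (A : KnownRepAlg) (s : List ((ℝ × ℝ) × ℕ)) : Prop :=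
  ∃ (n : ℕ) (x : Fin n → ℝ × ℝ), (∀ i, (x i).1 ≤ (x i).2) ∧
    s = (List.ofFn fun i => (x i, knownColoring A x i)).reverse

open Classical in
/-- The number of intervals of a transcript that contain the point `t`. -/
noncomputable def density (s : List ((ℝ × ℝ) × ℕ)) (t : ℝ) : ℕ :=
  s.countP fun a => t ∈ Set.Icc a.1.1 a.1.2

/-- The set of colors used in a transcript. -/
def colors (s : List ((ℝ × ℝ) × ℕ)) : Finset ℕ := (s.map Prod.snd).toFinset

lemma mem_colors {s : List ((ℝ × ℝ) × ℕ)} {c : ℕ} : c ∈ colors s ↔ ∃ a ∈ s, a.2 = c := by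
  simp [colors]

lemma colors_append (s s' : List ((ℝ × ℝ) × ℕ)) : colors (s ++ s') = colors s ∪ colors s' := by
  simp [colors]

lemma density_append (s s' : List ((ℝ × ℝ) × ℕ)) (t : ℝ) :
    density (s ++ s') t = density s t + density s' t := by
  simp [density]

lemma density_le_length (s : List ((ℝ × ℝ) × ℕ)) (t : ℝ) : density s t ≤ s.length :=
  List.countP_le_length

lemma density_eq_zero {s : List ((ℝ × ℝ) × ℕ)} {t : ℝ}
    (h : ∀ a ∈ s, t < a.1.1 ∨ a.1.2 < t) : density s t = 0 := by
  simp only [density, List.countP_eq_zero, decide_eq_true_eq, Set.mem_Icc, not_and_or, not_le]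
  exact h

lemma isTranscript_nil (A : KnownRepAlg) : IsTranscript A [] :=
  ⟨0, Fin.elim0, fun i => i.elim0, by simp⟩

lemma IsTranscript.exists_cons {A : KnownRepAlg} {s : List ((ℝ × ℝ) × ℕ)}
    (hs : IsTranscript A s) {I : ℝ × ℝ} (hI : I.1 ≤ I.2) :
    ∃ c, IsTranscript A ((I, c) :: s) := by
  obtain ⟨n, x, hx, rfl⟩ := hs
  let y : Fin (n + 1) → ℝ × ℝ := Fin.snoc (α := fun _ => ℝ × ℝ) x I
  have hy (i : Fin n) : y i.castSucc = x i := Fin.snoc_castSucc (α := fun _ => ℝ × ℝ) ..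
  have hlast : y (Fin.last n) = I := Fin.snoc_last (α := fun _ => ℝ × ℝ) ..
  refine ⟨knownColoring A y (Fin.last n), n + 1, y, fun i => ?_, ?_⟩
  · induction i using Fin.lastCases with
    | last => rwa [hlast]
    | cast i => rw [hy]; exact hx i
  · have hcol (i : Fin n) : knownColoring A y i.castSucc = knownColoring A x i :=
      congrArg (A i.1) (funext fun j => hy (Fin.castLE i.isLt j))
    rw [List.ofFn_succ']
    simp [hy, hlast, hcol]

lemma IsTranscript.pairwise {A : KnownRepAlg} (hA : IsProperKnown A)
    {s : List ((ℝ × ℝ) × ℕ)} (hs : IsTranscript A s) :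
    s.Pairwise fun a b =>
      (Set.Icc a.1.1 a.1.2 ∩ Set.Icc b.1.1 b.1.2).Nonempty → a.2 ≠ b.2 := by
  obtain ⟨n, x, hx, rfl⟩ := hs
  rw [List.pairwise_reverse, List.pairwise_ofFn]
  exact fun i j hij h => hA n x hx j i hij.ne' h

/-- Intervals of a transcript with a common point have pairwise distinct colors. -/
lemma IsTranscript.card_colors {A : KnownRepAlg} (hA : IsProperKnown A)
    {e s : List ((ℝ × ℝ) × ℕ)} (hs : IsTranscript A (e ++ s)) {t : ℝ}
    (ht : ∀ a ∈ e, t ∈ Set.Icc a.1.1 a.1.2) : (colors e).card = e.length := by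
  have h := (List.pairwise_append.1 (hs.pairwise hA)).1
  rw [colors, List.toFinset_card_of_nodup, List.length_map]
  rw [List.Nodup, List.pairwise_map]
  exact h.imp_of_mem fun ha hb hab => hab ⟨t, ht _ ha, ht _ hb⟩

/-- Later intervals avoid the colors of the earlier intervals that they all meet. -/
lemma IsTranscript.disjoint_colors {A : KnownRepAlg} (hA : IsProperKnown A)
    {e s : List ((ℝ × ℝ) × ℕ)} (hs : IsTranscript A (e ++ s)) {Z : Finset ℕ}
    (hZ : ∀ c ∈ Z, ∃ b ∈ s, b.2 = c ∧
      ∀ a ∈ e, (Set.Icc a.1.1 a.1.2 ∩ Set.Icc b.1.1 b.1.2).Nonempty) :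
    Disjoint (colors e) Z := by
  rw [Finset.disjoint_left]
  intro c hce hcZ
  obtain ⟨a, ha, rfl⟩ := mem_colors.1 hce
  obtain ⟨b, hb, hbc, hab⟩ := hZ _ hcZ
  exact (List.pairwise_append.1 (hs.pairwise hA)).2.2 a ha b hb (hab a ha) hbc.symm

lemma IsTranscript.exists_copies {A : KnownRepAlg} {s : List ((ℝ × ℝ) × ℕ)}
    (hs : IsTranscript A s) {I : ℝ × ℝ} (hI : I.1 ≤ I.2) (m : ℕ) :
    ∃ e, IsTranscript A (e ++ s) ∧ e.length = m ∧ ∀ a ∈ e, a.1 = I := by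
  induction m with
  | zero => exact ⟨[], hs, rfl, by simp⟩
  | succ m ih =>
    obtain ⟨e, he, hlen, heI⟩ := ih
    obtain ⟨c, hc⟩ := he.exists_cons hI
    exact ⟨(I, c) :: e, hc, by simp [hlen], by simpa using heI⟩

/-- Separation: a clique of unit intervals, the first `k` of which from the left (those that
start at or before `lo`) avoid the given `k` colors, while the others use them. -/
lemma exists_separated_clique {A : KnownRepAlg} (hA : IsProperKnown A) {k : ℕ}
    {R : Finset ℕ} (hR : R.card ≤ k) {s : List ((ℝ × ℝ) × ℕ)} (hs : IsTranscript A s)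
    {p q : ℝ} (hpq : p < q) (hq : q ≤ p + 1) :
    ∃ e lo hi, IsTranscript A (e ++ s) ∧ p ≤ lo ∧ lo < hi ∧ hi ≤ q ∧
      (∀ a ∈ e, a.1.2 = a.1.1 + 1 ∧ p ≤ a.1.1 ∧ a.1.1 ≤ q ∧
        (a.2 ∉ R ∧ a.1.1 ≤ lo ∨ a.2 ∈ R ∧ hi ≤ a.1.1)) ∧
      e.countP (fun a => a.2 ∉ R) = k ∧ e.length ≤ 2 * k := by
  have count_le {e : List ((ℝ × ℝ) × ℕ)} (he : IsTranscript A (e ++ s))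
      (h : ∀ a ∈ e, a.1.2 = a.1.1 + 1 ∧ p ≤ a.1.1 ∧ a.1.1 ≤ q) :
      e.length ≤ e.countP (fun a => a.2 ∉ R) + k := by
    have hcol := he.card_colors hA (t := q) fun a ha => by
      obtain ⟨h1, h2, h3⟩ := h a ha
      exact ⟨h3, by linarith⟩
    have hsub : colors e ⊆ R ∪ colors (e.filter fun a => a.2 ∉ R) := by
      intro c hc
      obtain ⟨a, ha, rfl⟩ := mem_colors.1 hc
      by_cases haR : a.2 ∈ R
      · exact Finset.mem_union_left _ haR
      · exact Finset.mem_union_right _ (mem_colors.2 ⟨a, by simp [ha, haR], rfl⟩)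
    have h1 := (Finset.card_le_card hsub).trans (Finset.card_union_le _ _)
    have h2 : (colors (e.filter fun a => a.2 ∉ R)).card ≤ e.countP (fun a => a.2 ∉ R) := by
      rw [List.countP_eq_length_filter]
      exact (List.toFinset_card_le _).trans (by simp)
    omega
  have key (m : ℕ) : ∃ e lo hi, IsTranscript A (e ++ s) ∧ p ≤ lo ∧ lo < hi ∧ hi ≤ q ∧
      (∀ a ∈ e, a.1.2 = a.1.1 + 1 ∧ p ≤ a.1.1 ∧ a.1.1 ≤ q ∧
        (a.2 ∉ R ∧ a.1.1 ≤ lo ∨ a.2 ∈ R ∧ hi ≤ a.1.1)) ∧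
      e.countP (fun a => a.2 ∉ R) ≤ k ∧
      (e.countP (fun a => a.2 ∉ R) = k ∨ e.length = m) := by
    induction m with
    | zero => exact ⟨[], p, q, hs, le_rfl, hpq, le_rfl, by simp, by simp, Or.inr rfl⟩
    | succ m ih =>
      obtain ⟨e, lo, hi, he, hlo, hlt, hhi, hmem, hle, hor⟩ := ih
      by_cases hk : e.countP (fun a => a.2 ∉ R) = k
      · exact ⟨e, lo, hi, he, hlo, hlt, hhi, hmem, hle, Or.inl hk⟩
      have hlen := hor.resolve_left hk
      obtain ⟨u, hu, hu'⟩ := exists_between hlt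
      obtain ⟨c, hc⟩ := he.exists_cons (I := (u, u + 1)) (by simp)
      by_cases hcR : c ∈ R
      · refine ⟨((u, u + 1), c) :: e, lo, u, hc, hlo, hu, by linarith, ?_, ?_, ?_⟩
        · rw [List.forall_mem_cons]
          refine ⟨⟨rfl, by simp; linarith, by simp; linarith, Or.inr ⟨hcR, le_rfl⟩⟩, ?_⟩
          intro a ha
          obtain ⟨h1, h2, h3, h4⟩ := hmem a ha
          exact ⟨h1, h2, h3, h4.imp id fun h => ⟨h.1, by linarith [h.2]⟩⟩
        · simpa [List.countP_cons, hcR] using hle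
        · simp [hlen]
      · refine ⟨((u, u + 1), c) :: e, u, hi, hc, by linarith, hu', hhi, ?_, ?_, ?_⟩
        · rw [List.forall_mem_cons]
          refine ⟨⟨rfl, by simp; linarith, by simp; linarith, Or.inl ⟨hcR, le_rfl⟩⟩, ?_⟩
          intro a ha
          obtain ⟨h1, h2, h3, h4⟩ := hmem a ha
          exact ⟨h1, h2, h3, h4.imp (fun h => ⟨h.1, by linarith [h.2]⟩) id⟩
        · rw [List.countP_cons_of_pos (by simpa using hcR)]
          omega
        · simp [hlen]
  obtain ⟨e, lo, hi, he, hlo, hlt, hhi, hmem, hle, hor⟩ := key (2 * k)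
  have h := count_le he fun a ha => ⟨(hmem a ha).1, (hmem a ha).2.1, (hmem a ha).2.2.1⟩
  exact ⟨e, lo, hi, he, hlo, hlt, hhi, hmem, by omega, by omega⟩

/-- Unit intervals of density `2 * k` in a bounded region can force `3 * k` colors. -/
lemma exists_unit_region {A : KnownRepAlg} (hA : IsProperKnown A) (k : ℕ)
    {s : List ((ℝ × ℝ) × ℕ)} (hs : IsTranscript A s) (p : ℝ) :
    ∃ e, IsTranscript A (e ++ s) ∧
      (∀ a ∈ e, a.1.2 = a.1.1 + 1 ∧ p ≤ a.1.1 ∧ a.1.2 ≤ p + 5) ∧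
      (∀ t, density e t ≤ 2 * k) ∧ 3 * k ≤ (colors e).card := by
  obtain ⟨f, hf, hflen, hfI⟩ := hs.exists_copies (I := (p, p + 1)) (by simp) k
  have hfcard := hf.card_colors hA (t := p) fun a ha => by simp [hfI a ha]
  obtain ⟨g, lo, hi, hg, hlo, hlt, hhi, hgmem, hgcount, hglen⟩ :=
    exists_separated_clique hA (hfcard.trans hflen).le hf
      (p := p + 3 / 2) (q := p + 7 / 4) (by linarith) (by linarith)
  obtain ⟨h, hh, hhlen, hhI⟩ := hg.exists_copies (I := (lo - 1, lo)) (by simp) k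
  set g' := g.filter fun a => a.2 ∉ colors f with hg'
  have hg'mem : ∀ a ∈ g', a ∈ g ∧ a.2 ∉ colors f := by simp [hg']
  have hg'lo : ∀ a ∈ g', a.1.1 ≤ lo := fun a ha =>
    ((hgmem a (hg'mem a ha).1).2.2.2.resolve_right fun h => (hg'mem a ha).2 h.1).2
  have hhcard := hh.card_colors hA (t := lo) fun a ha => by simp [hhI a ha]
  have hgf : Disjoint (colors g') (colors f) := by
    rw [Finset.disjoint_left]
    intro c hc
    obtain ⟨a, ha, rfl⟩ := mem_colors.1 hc
    exact (hg'mem a ha).2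
  have hg'card : (colors g').card = k := by
    rw [← hgcount, List.countP_eq_length_filter, ← hg', colors, List.toFinset_card_of_nodup,
      List.length_map]
    have hp := (List.pairwise_append.1 (hg.pairwise hA)).1.filter fun a => a.2 ∉ colors f
    rw [List.Nodup, List.pairwise_map]
    refine hp.imp_of_mem fun {a b} ha hb hab => hab ⟨p + 7 / 4, ?_, ?_⟩
    · obtain ⟨h1, h2, h3, -⟩ := hgmem a (hg'mem a ha).1
      exact ⟨h3, by linarith⟩
    · obtain ⟨h1, h2, h3, -⟩ := hgmem b (hg'mem b hb).1
      exact ⟨h3, by linarith⟩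
  have hdisj : Disjoint (colors h) (colors g' ∪ colors f) := by
    refine hh.disjoint_colors hA fun c hc => ?_
    rcases Finset.mem_union.1 hc with hc | hc
    · obtain ⟨b, hb, rfl⟩ := mem_colors.1 hc
      obtain ⟨h1, h2, -⟩ := hgmem b (hg'mem b hb).1
      refine ⟨b, by simp [(hg'mem b hb).1], rfl, fun a ha => ⟨lo, ?_⟩⟩
      rw [hhI a ha]
      refine ⟨by simp, hg'lo b hb, by linarith⟩
    · obtain ⟨b, hb, rfl⟩ := mem_colors.1 hc
      refine ⟨b, by simp [hb], rfl, fun a ha => ⟨p + 1, ?_⟩⟩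
      rw [hhI a ha, hfI b hb]
      exact ⟨⟨by simp; linarith, by simp; linarith⟩, by simp, by simp⟩
  refine ⟨h ++ g ++ f, by simpa using hh, ?_, fun t => ?_, ?_⟩
  · intro a ha
    rcases List.mem_append.1 ha with ha | ha
    · rcases List.mem_append.1 ha with ha | ha
      · rw [hhI a ha]
        exact ⟨by simp, by simp; linarith, by simp; linarith⟩
      · obtain ⟨h1, h2, h3, -⟩ := hgmem a ha
        exact ⟨h1, by linarith, by linarith⟩
    · rw [hfI a ha]
      exact ⟨by simp, by simp, by simp⟩
  · rw [density_append, density_append]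
    have h1 := density_le_length h t
    have h2 := density_le_length g t
    have h3 := density_le_length f t
    rcases le_or_gt t (p + 1) with ht | ht
    · have : density g t = 0 := density_eq_zero fun a ha =>
        Or.inl (by linarith [(hgmem a ha).2.1])
      omega
    · have hf0 : density f t = 0 := density_eq_zero fun a ha => by
        rw [hfI a ha]
        exact Or.inr ht
      rcases le_or_gt t lo with ht' | ht'
      · have : density g t ≤ k := by
          rw [← hgcount]
          refine List.countP_mono_left fun a ha hta => ?_
          simp only [decide_eq_true_eq, Set.mem_Icc] at hta ⊢
          rcases (hgmem a ha).2.2.2 with h | h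
          · exact h.1
          · linarith [h.2]
        omega
      · have : density h t = 0 := density_eq_zero fun a ha => by
          rw [hhI a ha]
          exact Or.inr ht'
        omega
  · have hsub : colors h ∪ (colors g' ∪ colors f) ⊆ colors (h ++ g ++ f) := by
      rw [colors_append, colors_append, Finset.union_assoc]
      refine Finset.union_subset_union_right (Finset.union_subset_union_left fun c hc => ?_)
      obtain ⟨a, ha, rfl⟩ := mem_colors.1 hc
      exact mem_colors.2 ⟨a, (hg'mem a ha).1, rfl⟩
    have hcard := Finset.card_le_card hsub
    rw [Finset.card_union_of_disjoint hdisj, Finset.card_union_of_disjoint hgf] at hcard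
    omega

/-- The strategy of `exists_unit_region` played in `N` consecutive regions, region `i` lying
in `[10 * i, 10 * i + 5]`. -/
lemma exists_unit_regions {A : KnownRepAlg} (hA : IsProperKnown A) (k N : ℕ) :
    ∃ (s : List ((ℝ × ℝ) × ℕ)) (Z : ℕ → Finset ℕ), IsTranscript A s ∧
      (∀ a ∈ s, a.1.2 = a.1.1 + 1 ∧ ∃ i < N, 10 * (i : ℝ) ≤ a.1.1 ∧ a.1.2 ≤ 10 * i + 5) ∧
      (∀ t, density s t ≤ 2 * k) ∧
      ∀ i < N, 3 * k ≤ (Z i).card ∧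
        ∀ c ∈ Z i, ∃ b ∈ s, b.2 = c ∧ 10 * (i : ℝ) ≤ b.1.1 ∧ b.1.2 ≤ 10 * i + 5 := by
  induction N with
  | zero => exact ⟨[], fun _ => ∅, isTranscript_nil A, by simp, by simp [density], by simp⟩
  | succ N ih =>
    obtain ⟨s, Z, hs, hmem, hdens, hZ⟩ := ih
    obtain ⟨e, he, hemem, hedens, hecard⟩ := exists_unit_region hA k hs (10 * N)
    refine ⟨e ++ s, Function.update Z N (colors e), he, fun a ha => ?_, fun t => ?_,
      fun i hi => ?_⟩
    · rcases List.mem_append.1 ha with ha | ha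
      · obtain ⟨h1, h2, h3⟩ := hemem a ha
        exact ⟨h1, N, by omega, h2, h3⟩
      · obtain ⟨h1, i, hi, h⟩ := hmem a ha
        exact ⟨h1, i, by omega, h⟩
    · rw [density_append]
      rcases lt_or_ge t (10 * N) with ht | ht
      · rw [density_eq_zero fun a ha => Or.inl (by linarith [(hemem a ha).2.1])]
        simpa using hdens t
      · rw [density_eq_zero (s := s) fun a ha => Or.inr ?_]
        · simpa using hedens t
        · obtain ⟨-, i, hi, -, h⟩ := hmem a ha
          have : (i : ℝ) + 1 ≤ N := by exact_mod_cast hi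
          linarith
    · rcases eq_or_ne i N with rfl | hne
      · rw [Function.update_self]
        refine ⟨hecard, fun c hc => ?_⟩
        obtain ⟨b, hb, hbc⟩ := mem_colors.1 hc
        exact ⟨b, by simp [hb], hbc, (hemem b hb).2⟩
      · rw [Function.update_of_ne hne]
        obtain ⟨h1, h2⟩ := hZ i (by omega)
        refine ⟨h1, fun c hc => ?_⟩
        obtain ⟨b, hb, h⟩ := h2 c hc
        exact ⟨b, by simp [hb], h⟩

/-- The transcript form of the lower bound: two regions with the same `3 * k` colors are met by
two intersecting bundles of `2 * k` long intervals, one bundle for each region. -/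
lemma exists_transcript {A : KnownRepAlg} (hA : IsProperKnown A) (k : ℕ) {L : ℝ}
    (hL : L = 10 * 2 ^ (7 * k) + 20) :
    ∃ s, IsTranscript A s ∧ (∀ a ∈ s, a.1.2 - a.1.1 = 1 ∨ a.1.2 - a.1.1 = L) ∧
      (∀ t, density s t ≤ 4 * k) ∧ 7 * k ≤ (colors s).card := by
  obtain ⟨s, Z, hs, hmem, hdens, hZ⟩ := exists_unit_regions hA k (2 ^ (7 * k))
  have hunit : ∀ a ∈ s, a.1.2 - a.1.1 = 1 := fun a ha => by linarith [(hmem a ha).1]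
  rcases le_or_gt (7 * k) (colors s).card with hcol | hcol
  · exact ⟨s, hs, fun a ha => Or.inl (hunit a ha), fun t => (hdens t).trans (by omega), hcol⟩
  obtain ⟨i, j, hij, hj, hZij⟩ : ∃ i j, i < j ∧ j < 2 ^ (7 * k) ∧ Z i = Z j := by
    obtain ⟨i, hi, j, hj, hne, heq⟩ := Finset.exists_ne_map_eq_of_card_lt_of_maps_to
      (s := Finset.range (2 ^ (7 * k))) (t := (colors s).powerset) (f := Z)
      (by
        rw [Finset.card_powerset, Finset.card_range]
        exact Nat.pow_lt_pow_right (by norm_num) hcol)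
      (fun i hi => by
        refine Finset.mem_coe.2 (Finset.mem_powerset.2 fun c hc => ?_)
        obtain ⟨b, hb, hbc, -⟩ := (hZ i (by simpa using hi)).2 c hc
        exact mem_colors.2 ⟨b, hb, hbc⟩)
    simp only [Finset.mem_range] at hi hj
    rcases lt_or_gt_of_ne hne with h | h
    · exact ⟨i, j, h, hj, heq⟩
    · exact ⟨j, i, h, hi, heq.symm⟩
  have hi : i < 2 ^ (7 * k) := hij.trans hj
  have hij' : (i : ℝ) + 1 ≤ j := by exact_mod_cast hij
  have hj' : (j : ℝ) + 1 ≤ 2 ^ (7 * k) := by exact_mod_cast hj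
  have hi0 : (0 : ℝ) ≤ i := i.cast_nonneg
  set q : ℝ := 10 * i + 6 with hq
  obtain ⟨f, hf, hflen, hfI⟩ := hs.exists_copies (I := (q - L, q)) (by simp; linarith) (2 * k)
  obtain ⟨g, hg, hglen, hgI⟩ := hf.exists_copies (I := (q, q + L)) (by simp; linarith) (2 * k)
  have hfcard := hf.card_colors hA (t := q) fun a ha => by
    rw [hfI a ha]; exact ⟨by simp; linarith, le_rfl⟩
  have hgcard := hg.card_colors hA (t := q) fun a ha => by
    rw [hgI a ha]; exact ⟨le_rfl, by simp; linarith⟩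
  have hfZ : Disjoint (colors f) (Z i) := by
    refine hf.disjoint_colors hA fun c hc => ?_
    obtain ⟨b, hb, hbc, h1, h2⟩ := (hZ i hi).2 c hc
    have h3 := hunit b hb
    refine ⟨b, hb, hbc, fun a ha => ⟨b.1.1, ?_, le_rfl, by linarith⟩⟩
    rw [hfI a ha]
    exact ⟨by simp; linarith, by simp; linarith⟩
  have hgZ : Disjoint (colors g) (colors f ∪ Z i) := by
    refine hg.disjoint_colors hA fun c hc => ?_
    rcases Finset.mem_union.1 hc with hc | hc
    · obtain ⟨b, hb, rfl⟩ := mem_colors.1 hc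
      refine ⟨b, by simp [hb], rfl, fun a ha => ⟨q, ?_⟩⟩
      rw [hgI a ha, hfI b hb]
      exact ⟨⟨le_rfl, by simp; linarith⟩, by simp; linarith, le_rfl⟩
    · rw [hZij] at hc
      obtain ⟨b, hb, hbc, h1, h2⟩ := (hZ j hj).2 c hc
      have h3 := hunit b hb
      refine ⟨b, by simp [hb], hbc, fun a ha => ⟨b.1.1, ?_, le_rfl, by linarith⟩⟩
      rw [hgI a ha]
      exact ⟨by simp; linarith, by simp; linarith⟩
  refine ⟨g ++ (f ++ s), hg, fun a ha => ?_, fun t => ?_, ?_⟩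
  · simp only [List.mem_append] at ha
    rcases ha with ha | ha | ha
    · rw [hgI a ha]; right; simp
    · rw [hfI a ha]; right; simp
    · exact Or.inl (hunit a ha)
  · rw [density_append, density_append]
    have h1 := density_le_length g t
    have h2 := density_le_length f t
    have h3 := hdens t
    rcases lt_trichotomy t q with ht | rfl | ht
    · have : density g t = 0 := density_eq_zero fun a ha => by
        rw [hgI a ha]; exact Or.inl ht
      omega
    · have : density s q = 0 := density_eq_zero fun a ha => by
        obtain ⟨-, l, -, hl, hl'⟩ := hmem a ha
        rcases le_or_gt l i with h | h
        · have : (l : ℝ) ≤ i := by exact_mod_cast h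
          right; linarith
        · have : (i : ℝ) + 1 ≤ l := by exact_mod_cast h
          left; linarith
      omega
    · have : density f t = 0 := density_eq_zero fun a ha => by
        rw [hfI a ha]; exact Or.inr ht
      omega
  · have hsub : colors g ∪ (colors f ∪ Z i) ⊆ colors (g ++ (f ++ s)) := by
      rw [colors_append, colors_append]
      refine Finset.union_subset_union_right (Finset.union_subset_union_right fun c hc => ?_)
      obtain ⟨b, hb, hbc, -⟩ := (hZ i hi).2 c hc
      exact mem_colors.2 ⟨b, hb, hbc⟩
    have hcard := Finset.card_le_card hsub
    rw [Finset.card_union_of_disjoint hgZ, Finset.card_union_of_disjoint hfZ] at hcard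
    have := (hZ i hi).1
    omega

theorem stmt12 (k : ℕ) (hk : 1 ≤ k) :
    ∃ L : ℝ, 1 ≤ L ∧
      ∀ A : KnownRepAlg, IsProperKnown A →
        ∃ (n : ℕ) (x : Fin n → ℝ × ℝ),
          (∀ i, (x i).2 - (x i).1 = 1 ∨ (x i).2 - (x i).1 = L) ∧
          (∀ t : ℝ, {i : Fin n | t ∈ Set.Icc (x i).1 (x i).2}.ncard ≤ 4 * k) ∧
          7 * k ≤ (Set.range (knownColoring A x)).ncard := by
  refine ⟨10 * 2 ^ (7 * k) + 20, ?_, fun A hA => ?_⟩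
  · have : (0 : ℝ) ≤ 2 ^ (7 * k) := by positivity
    linarith
  obtain ⟨s, ⟨n, x, -, rfl⟩, hlen, hdens, hcol⟩ := exists_transcript hA k rfl
  refine ⟨n, x, fun i => ?_, fun t => ?_, ?_⟩
  · exact hlen (x i, knownColoring A x i) (by simpa using ⟨i, rfl, rfl⟩)
  · classical
    convert hdens t using 1
    rw [density, List.countP_reverse, List.ofFn_eq_map, List.countP_map,
      List.countP_eq_length_filter, ← List.toFinset_card_of_nodup
        ((List.nodup_finRange n).filter _), ← Set.ncard_coe_finset]
    congr 1
    ext i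
    simp
  · convert hcol using 1
    rw [← Set.ncard_coe_finset]
    congr 1
    ext c
    simp [colors]
end
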